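/- arXiv:1211.2120 — 9 statements merged into one kernel-verified Lean document; each statement's English description precedes it below -/
import Mathlib

section
/- Let E and F be real Banach spaces, D ⊆ E open, f : D → F analytic, and x₀ ∈ D a point at which Df(x₀) is invertible as a continuous linear isomorphism. Suppose the Taylor series of f at x₀, namely f(x₀) + Df(x₀)(x−x₀) + Σ_{k≥2} (1/k!)·D^k f(x₀)(x−x₀)^k, converges uniformly on the open ball B(x₀,ρ) for some ρ > 0. Then limsup_{k→∞} ‖(1/k!)·Df(x₀)⁻¹ ∘ D^k f(x₀)‖^{1/(k−1)} ≤ e/ρ; in particular Smale's invariant γ(f,x₀) is finite. -/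
open Filter Metric

/-- The k-th term whose supremum over `k ≥ 2` defines Smale's gamma invariant:
`‖(1/k!) · Df(x)⁻¹ ∘ D^k f(x)‖^(1/(k-1))`, where `dinv` plays the role of `Df(x)⁻¹`. -/
noncomputable def gammaTerm {E F : Type*} [NormedAddCommGroup E] [NormedSpace ℝ E]
    [NormedAddCommGroup F] [NormedSpace ℝ F]
    (f : E → F) (dinv : F →L[ℝ] E) (x : E) (k : ℕ) : ℝ :=
  (‖dinv.compContinuousMultilinearMap (iteratedFDeriv ℝ k f x)‖ / (Nat.factorial k : ℝ)) ^
    ((1 : ℝ) / ((k : ℝ) - 1))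

/-- The set of values `gammaTerm f dinv x k` for `k ≥ 2`. -/
noncomputable def gammaSet {E F : Type*} [NormedAddCommGroup E] [NormedSpace ℝ E]
    [NormedAddCommGroup F] [NormedSpace ℝ F]
    (f : E → F) (dinv : F →L[ℝ] E) (x : E) : Set ℝ :=
  {g : ℝ | ∃ k : ℕ, 2 ≤ k ∧ g = gammaTerm f dinv x k}

/-- Smale's gamma invariant `γ(f,x) = sup_{k ≥ 2} ‖(1/k!)·Df(x)⁻¹ ∘ D^k f(x)‖^(1/(k-1))`. -/
noncomputable def smaleGamma {E F : Type*} [NormedAddCommGroup E] [NormedSpace ℝ E]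
    [NormedAddCommGroup F] [NormedSpace ℝ F]
    (f : E → F) (dinv : F →L[ℝ] E) (x : E) : ℝ :=
  sSup (gammaSet f dinv x)


/-- The sign `±1` attached to a Boolean. -/
noncomputable def polSign (b : Bool) : ℝ := if b then 1 else -1

lemma polSign_norm (b : Bool) : ‖polSign b‖ = 1 := by
  cases b <;> simp [polSign]

lemma polSign_sq (b : Bool) : polSign b * polSign b = 1 := by
  cases b <;> simp [polSign]

lemma polSign_coeff {k : ℕ} (r : Fin k → Fin k) (hr : ¬ Function.Bijective r) :
    ∑ e : Fin k → Bool, (∏ i, polSign (e i)) * ∏ j, polSign (e (r j)) = 0 := by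
  have hs : ¬ Function.Surjective r := fun h => hr (Finite.surjective_iff_bijective.1 h)
  simp only [Function.Surjective, not_forall, not_exists] at hs
  obtain ⟨i₀, hi₀⟩ := hs
  refine Finset.sum_involution (fun e _ => Function.update e i₀ (!(e i₀))) ?_ ?_ ?_ ?_
  · intro e _
    have h1 : ∏ j, polSign (Function.update e i₀ (!(e i₀)) (r j)) = ∏ j, polSign (e (r j)) := by
      refine Finset.prod_congr rfl fun j _ => ?_
      rw [Function.update_of_ne (hi₀ j)]
    have h2 : ∏ i, polSign (Function.update e i₀ (!(e i₀)) i) = - ∏ i, polSign (e i) := by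
      rw [← Finset.mul_prod_erase _ _ (Finset.mem_univ i₀),
        ← Finset.mul_prod_erase _ (fun i => polSign (e i)) (Finset.mem_univ i₀)]
      have h3 : ∏ i ∈ Finset.univ.erase i₀, polSign (Function.update e i₀ (!(e i₀)) i)
          = ∏ i ∈ Finset.univ.erase i₀, polSign (e i) := by
        refine Finset.prod_congr rfl fun j hj => ?_
        rw [Function.update_of_ne (Finset.ne_of_mem_erase hj)]
      rw [h3]
      simp only [Function.update_self]
      cases e i₀ <;> simp [polSign]
    rw [h1, h2]
    ring
  · intro e _ _ h
    have := congrFun h i₀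
    simp at this
  · intro e _
    exact Finset.mem_univ _
  · intro e _
    simp

lemma polSign_coeff_bij {k : ℕ} (r : Fin k → Fin k) (hr : Function.Bijective r) :
    ∑ e : Fin k → Bool, (∏ i, polSign (e i)) * ∏ j, polSign (e (r j)) = 2 ^ k := by
  have : ∀ e : Fin k → Bool, (∏ i, polSign (e i)) * ∏ j, polSign (e (r j)) = 1 := by
    intro e
    rw [hr.prod_comp (fun i => polSign (e i)), ← Finset.prod_mul_distrib]
    simp [polSign_sq]
  simp [this]

lemma card_bij (k : ℕ) :
    (Finset.univ.filter (fun r : Fin k → Fin k => Function.Bijective r)).card = k.factorial := by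
  classical
  rw [← Fintype.card_subtype, ← Fintype.card_congr (Equiv.ofBijective
    (fun σ : Equiv.Perm (Fin k) =>
      (⟨σ, σ.bijective⟩ : {r : Fin k → Fin k // Function.Bijective r})) ⟨?_, ?_⟩)]
  · simp [Fintype.card_perm]
  · intro a b h
    simpa using h
  · rintro ⟨r, hr⟩
    exact ⟨Equiv.ofBijective r hr, by ext; simp⟩

section
variable {E F : Type*} [NormedAddCommGroup E] [NormedSpace ℝ E]
    [NormedAddCommGroup F] [NormedSpace ℝ F]

lemma polarization_identity {k : ℕ} (L : ContinuousMultilinearMap ℝ (fun _ : Fin k => E) F)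
    (hL : ∀ (v : Fin k → E) (σ : Equiv.Perm (Fin k)), L (v ∘ σ) = L v) (v : Fin k → E) :
    ∑ e : Fin k → Bool, (∏ i, polSign (e i)) • L (fun _ => ∑ i, polSign (e i) • v i)
      = ((2 : ℝ) ^ k * k.factorial) • L v := by
  classical
  have h1 : ∀ e : Fin k → Bool, L (fun _ => ∑ i, polSign (e i) • v i)
      = ∑ r : Fin k → Fin k, (∏ j, polSign (e (r j))) • L (v ∘ r) := by
    intro e
    rw [L.map_sum]
    refine Finset.sum_congr rfl fun r _ => ?_
    exact L.map_smul_univ (fun j => polSign (e (r j))) (fun j => v (r j))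
  simp only [h1, Finset.smul_sum, smul_smul]
  rw [Finset.sum_comm]
  simp only [← Finset.sum_smul]
  rw [← Finset.sum_filter_add_sum_filter_not Finset.univ
    (fun r : Fin k → Fin k => Function.Bijective r)]
  have h2 : ∀ r ∈ Finset.univ.filter (fun r : Fin k → Fin k => Function.Bijective r),
      (∑ e : Fin k → Bool, (∏ i, polSign (e i)) * ∏ j, polSign (e (r j))) • L (v ∘ r)
        = (2 : ℝ) ^ k • L v := by
    intro r hr
    have hb := (Finset.mem_filter.1 hr).2
    rw [polSign_coeff_bij r hb]
    congr 1
    exact hL v (Equiv.ofBijective r hb)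
  have h3 : ∀ r ∈ Finset.univ.filter (fun r : Fin k → Fin k => ¬ Function.Bijective r),
      (∑ e : Fin k → Bool, (∏ i, polSign (e i)) * ∏ j, polSign (e (r j))) • L (v ∘ r) = 0 := by
    intro r hr
    rw [polSign_coeff r (Finset.mem_filter.1 hr).2, zero_smul]
  rw [Finset.sum_congr rfl h2, Finset.sum_eq_zero h3, add_zero, Finset.sum_const, card_bij,
    ← Nat.cast_smul_eq_nsmul ℝ, smul_smul, mul_comm]

/-- Polarization bound: a symmetric form with `‖L(y,…,y)‖ ≤ M` on the open ball of radius `ρ`. -/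
lemma polarization_bound {k : ℕ} (L : ContinuousMultilinearMap ℝ (fun _ : Fin k => E) F)
    (hL : ∀ (v : Fin k → E) (σ : Equiv.Perm (Fin k)), L (v ∘ σ) = L v)
    {M ρ : ℝ} (hM : 0 ≤ M) (hρ : 0 < ρ)
    (hb : ∀ y : E, ‖y‖ < ρ → ‖L (fun _ => y)‖ ≤ M) :
    ‖L‖ ≤ M * (Real.exp 1 / ρ) ^ k := by
  -- homogeneous bound
  have hom : ∀ y : E, ‖L (fun _ => y)‖ ≤ M * (‖y‖ / ρ) ^ k := by
    intro y
    have key : ∀ t : ℝ, ‖y‖ < t → ‖L (fun _ => y)‖ ≤ M * (t / ρ) ^ k := by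
      intro t ht
      have ht0 : 0 < t := lt_of_le_of_lt (norm_nonneg _) ht
      have h1 := hb ((ρ / t) • y) (by
        rw [norm_smul, Real.norm_of_nonneg (by positivity), div_mul_eq_mul_div, div_lt_iff₀ ht0]
        exact mul_lt_mul_of_pos_left ht hρ)
      have h2 : L (fun _ => (ρ / t) • y) = (ρ / t) ^ k • L (fun _ => y) := by
        have := L.map_smul_univ (fun _ => ρ / t) (fun _ => y)
        simpa only [Finset.prod_const, Finset.card_univ, Fintype.card_fin] using this
      rw [h2, norm_smul, Real.norm_of_nonneg (by positivity)] at h1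
      have h3 : (t / ρ) ^ k * ((ρ / t) ^ k * ‖L (fun _ => y)‖) = ‖L (fun _ => y)‖ := by
        rw [← mul_assoc, ← mul_pow]
        have : t / ρ * (ρ / t) = 1 := by field_simp
        rw [this, one_pow, one_mul]
      rw [← h3, mul_comm M]
      exact mul_le_mul_of_nonneg_left h1 (by positivity)
    have hc : Tendsto (fun t : ℝ => M * (t / ρ) ^ k) (nhdsWithin ‖y‖ (Set.Ioi ‖y‖))
        (nhds (M * (‖y‖ / ρ) ^ k)) := by
      have : Continuous (fun t : ℝ => M * (t / ρ) ^ k) := by fun_prop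
      exact (this.tendsto _).mono_left nhdsWithin_le_nhds
    refine ge_of_tendsto hc ?_
    filter_upwards [self_mem_nhdsWithin] with t ht using key t ht
  have hexp : (k : ℝ) ^ k / k.factorial ≤ Real.exp 1 ^ k := by
    have := Real.pow_div_factorial_le_exp (x := (k : ℝ)) (by positivity) k
    rwa [← Real.exp_nat_mul, mul_one]
  -- bound on vectors of norm ≤ 1
  have hunit : ∀ v : Fin k → E, (∀ i, ‖v i‖ ≤ 1) → ‖L v‖ ≤ M * (Real.exp 1 / ρ) ^ k := by
    intro v hv
    have hid := congrArg norm (polarization_identity L hL v)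
    rw [norm_smul, Real.norm_of_nonneg (by positivity)] at hid
    have hle : ‖∑ e : Fin k → Bool, (∏ i, polSign (e i)) • L (fun _ => ∑ i, polSign (e i) • v i)‖
        ≤ 2 ^ k * (M * (k / ρ) ^ k) := by
      refine (norm_sum_le _ _).trans ?_
      have : ∀ e ∈ (Finset.univ : Finset (Fin k → Bool)),
          ‖(∏ i, polSign (e i)) • L (fun _ => ∑ i, polSign (e i) • v i)‖ ≤ M * (k / ρ) ^ k := by
        intro e _
        rw [norm_smul, norm_prod]
        simp only [polSign_norm, Finset.prod_const_one, one_mul]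
        refine (hom _).trans ?_
        have : ‖∑ i, polSign (e i) • v i‖ ≤ k := by
          refine (norm_sum_le _ _).trans ?_
          refine (Finset.sum_le_card_nsmul _ _ 1 fun i _ => ?_).trans ?_
          · rw [norm_smul, polSign_norm, one_mul]; exact hv i
          · simp
        gcongr
      refine (Finset.sum_le_card_nsmul _ _ _ this).trans ?_
      simp
    rw [hid] at hle
    have hf : (0 : ℝ) < k.factorial := by positivity
    have h4 : ‖L v‖ ≤ M * ((k : ℝ) ^ k / k.factorial) / ρ ^ k := by
      rw [mul_assoc] at hle
      have := le_of_mul_le_mul_left hle (by positivity)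
      rw [div_pow] at this
      have h5 : M * ((k : ℝ) ^ k / k.factorial) / ρ ^ k
          = (M * ((k : ℝ) ^ k / ρ ^ k)) / k.factorial := by ring
      rw [h5, le_div_iff₀ hf, mul_comm]
      exact this
    refine h4.trans ?_
    rw [div_pow, ← mul_div_assoc M (Real.exp 1 ^ k)]
    exact div_le_div_of_nonneg_right (mul_le_mul_of_nonneg_left hexp hM) (by positivity)
  refine L.opNorm_le_bound (by positivity) fun m => ?_
  by_cases hz : ∃ i, m i = 0
  · obtain ⟨i, hi⟩ := hz
    rw [L.map_coord_zero i hi, norm_zero]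
    positivity
  · push Not at hz
    have h6 := hunit (fun i => ‖m i‖⁻¹ • m i) (fun i => by
      rw [norm_smul, norm_inv, norm_norm, inv_mul_cancel₀ (norm_ne_zero_iff.2 (hz i))])
    rw [L.map_smul_univ, norm_smul, Finset.prod_inv_distrib, norm_inv,
      Real.norm_of_nonneg (by positivity), inv_mul_le_iff₀
        (Finset.prod_pos fun i _ => norm_pos_iff.2 (hz i))] at h6
    rw [mul_comm]
    exact h6

end

/-- if the Taylor series of the analytic map `f` at `x₀` converges uniformly
on `B(x₀, ρ)`, then `limsup_k ‖(1/k!)·Df(x₀)⁻¹ ∘ D^k f(x₀)‖^(1/(k-1)) ≤ e/ρ`; in particular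
Smale's invariant `γ(f, x₀)` is finite. -/
theorem stmt0 {E F : Type*} [NormedAddCommGroup E] [NormedSpace ℝ E] [CompleteSpace E]
    [NormedAddCommGroup F] [NormedSpace ℝ F] [CompleteSpace F]
    (D : Set E) (hD : IsOpen D) (f : E → F) (hf : AnalyticOnNhd ℝ f D)
    (x₀ : E) (hx₀ : x₀ ∈ D)
    (A : E ≃L[ℝ] F) (hA : (A : E →L[ℝ] F) = fderiv ℝ f x₀)
    (ρ : ℝ) (hρ : 0 < ρ)
    (hconv : TendstoUniformlyOn
      (fun n x => ∑ k ∈ Finset.range (n + 1),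
        ((Nat.factorial k : ℝ))⁻¹ • iteratedFDeriv ℝ k f x₀ (fun _ => x - x₀))
      f atTop (Metric.ball x₀ ρ)) :
    Filter.limsup (fun k => gammaTerm f (A.symm : F →L[ℝ] E) x₀ k) Filter.atTop
        ≤ Real.exp 1 / ρ ∧
      BddAbove (gammaSet f (A.symm : F →L[ℝ] E) x₀) := by
  have hsym : ∀ k (v : Fin k → E) (σ : Equiv.Perm (Fin k)),
      iteratedFDeriv ℝ k f x₀ (v ∘ σ) = iteratedFDeriv ℝ k f x₀ v := by
    intro k v σ
    exact (hf x₀ hx₀).contDiffAt.iteratedFDeriv_comp_perm v σ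
  -- terms are eventually bounded by one on the ball
  have hterm : ∀ᶠ k : ℕ in atTop, ∀ y : E, ‖y‖ < ρ →
      ‖iteratedFDeriv ℝ k f x₀ (fun _ => y)‖ ≤ (Nat.factorial k : ℝ) := by
    have h1 := Metric.tendstoUniformlyOn_iff.1 hconv (1 / 2) (by norm_num)
    obtain ⟨N, hN⟩ := eventually_atTop.1 h1
    refine eventually_atTop.2 ⟨N + 1, fun k hk y hy => ?_⟩
    obtain ⟨n, rfl⟩ : ∃ n, k = n + 1 := ⟨k - 1, by omega⟩
    have hmem : x₀ + y ∈ Metric.ball x₀ ρ := by simpa using hy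
    have ha := hN n (by omega) _ hmem
    have hb := hN (n + 1) (by omega) _ hmem
    rw [Finset.sum_range_succ] at hb
    simp only [add_sub_cancel_left] at ha hb
    have hc : ‖((Nat.factorial (n + 1) : ℝ))⁻¹ • iteratedFDeriv ℝ (n + 1) f x₀ (fun _ => y)‖
        ≤ 1 := by
      rw [dist_eq_norm] at ha hb
      set S := ∑ k ∈ Finset.range (n + 1),
        ((Nat.factorial k : ℝ))⁻¹ • iteratedFDeriv ℝ k f x₀ (fun _ => y)
      set T := ((Nat.factorial (n + 1) : ℝ))⁻¹ • iteratedFDeriv ℝ (n + 1) f x₀ (fun _ => y)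
      have : T = (f (x₀ + y) - S) - (f (x₀ + y) - (S + T)) := by abel
      rw [this]
      refine (norm_sub_le _ _).trans ?_
      linarith
    rw [norm_smul, norm_inv, Real.norm_of_nonneg (by positivity),
      inv_mul_le_iff₀ (by positivity), mul_one] at hc
    exact hc
  set B : F →L[ℝ] E := (A.symm : F →L[ℝ] E) with hB
  set C : ℝ := ‖B‖ + 1 with hC
  have hCpos : 0 < C := by positivity
  set q : ℝ := Real.exp 1 / ρ with hq
  have hqpos : 0 < q := by positivity
  have hbound : ∀ᶠ k : ℕ in atTop, gammaTerm f B x₀ k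
      ≤ C ^ ((1 : ℝ) / ((k : ℝ) - 1)) * q ^ (1 + (1 : ℝ) / ((k : ℝ) - 1)) := by
    filter_upwards [hterm, eventually_ge_atTop 2] with k hk hk2
    have hk2' : (2 : ℝ) ≤ k := by exact_mod_cast hk2
    have hn := polarization_bound _ (hsym k) (by positivity) hρ hk
    have hcomp := B.norm_compContinuousMultilinearMap_le (iteratedFDeriv ℝ k f x₀)
    have h1 : ‖B.compContinuousMultilinearMap (iteratedFDeriv ℝ k f x₀)‖ / (Nat.factorial k : ℝ)
        ≤ C * q ^ k := by
      rw [div_le_iff₀ (by positivity)]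
      refine hcomp.trans ?_
      calc ‖B‖ * ‖iteratedFDeriv ℝ k f x₀‖ ≤ C * ((Nat.factorial k : ℝ) * q ^ k) := by
            gcongr
            linarith
        _ = _ := by ring
    have hexp : (0 : ℝ) ≤ 1 / ((k : ℝ) - 1) := by
      apply div_nonneg <;> linarith
    refine (Real.rpow_le_rpow (by positivity) h1 hexp).trans (le_of_eq ?_)
    rw [Real.mul_rpow hCpos.le (by positivity), ← Real.rpow_natCast q k, ← Real.rpow_mul hqpos.le]
    congr 2
    have : (k : ℝ) - 1 ≠ 0 := by linarith
    field_simp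
    ring
  have hlim0 : Tendsto (fun k : ℕ => (1 : ℝ) / ((k : ℝ) - 1)) atTop (nhds 0) := by
    apply Tendsto.const_div_atTop
    exact tendsto_atTop_add_const_right _ (-1 : ℝ) tendsto_natCast_atTop_atTop
  have hlim : Tendsto (fun k : ℕ => C ^ ((1 : ℝ) / ((k : ℝ) - 1)) *
      q ^ (1 + (1 : ℝ) / ((k : ℝ) - 1))) atTop (nhds q) := by
    have h1 := (tendsto_const_nhds (x := C)).rpow hlim0 (Or.inl hCpos.ne')
    have h2 := (tendsto_const_nhds (x := q)).rpow
      ((tendsto_const_nhds (x := (1 : ℝ))).add hlim0) (Or.inl hqpos.ne')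
    have := h1.mul h2
    simpa using this
  have hnn : ∀ k, 0 ≤ gammaTerm f B x₀ k := fun k => by
    unfold gammaTerm; positivity
  constructor
  · rw [← hlim.limsup_eq]
    refine limsup_le_limsup hbound ?_ hlim.isBoundedUnder_le
    exact (isBoundedUnder_of ⟨0, hnn⟩ :
      IsBoundedUnder (· ≥ ·) atTop (fun k => gammaTerm f B x₀ k)).isCoboundedUnder_le
  · have hbd : IsBoundedUnder (· ≤ ·) atTop (fun k => gammaTerm f B x₀ k) :=
      hlim.isBoundedUnder_le.mono_le hbound
    refine hbd.bddAbove_range.mono ?_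
    rintro g ⟨k, _, rfl⟩
    exact ⟨k, rfl⟩
end

section
/- Let E and F be real Banach spaces and let k ≥ 2 be an integer. Let T : E^k → F be a continuous symmetric k-linear map and let S : E → F be the associated polynomial map S(x) = T(x, x, …, x). Then ‖T‖ ≤ e^{k−1} · sup_{‖x‖ ≤ 1} ‖S(x)‖, where ‖T‖ = sup{‖T(u₁,…,u_k)‖ : ‖u₁‖ = ⋯ = ‖u_k‖ = 1} is the operator norm of the multilinear map. -/
theorem sign_sum_aux {k : ℕ} (f : Fin k → Fin k) :
    ∑ ε : Fin k → ℤˣ, (((∏ i, ε i) * ∏ j, ε (f j) : ℤˣ) : ℤ)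
      = if Function.Bijective f then 2 ^ k else 0 := by
  split_ifs with hf
  · have h : ∀ ε : Fin k → ℤˣ, (∏ i, ε i) * ∏ j, ε (f j) = 1 := by
      intro ε
      rw [hf.prod_comp (fun i => ε i)]
      exact Int.units_mul_self _
    simp [h, Fintype.card_pi]
  · have hs : ¬ Function.Surjective f := fun h => hf (Finite.injective_iff_surjective.mpr h |>.bijective_of_finite)
    simp only [Function.Surjective, not_forall, not_exists] at hs
    obtain ⟨b, hb⟩ := hs
    have h := Equiv.sum_comp (Equiv.mulLeft (Pi.mulSingle b (-1 : ℤˣ) : Fin k → ℤˣ))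
      (fun ε : Fin k → ℤˣ => (((∏ i, ε i) * ∏ j, ε (f j) : ℤˣ) : ℤ))
    have h2 : ∀ ε : Fin k → ℤˣ, ∏ j, (Pi.mulSingle b (-1 : ℤˣ) : Fin k → ℤˣ) (f j) = 1 := by
      intro ε
      apply Finset.prod_eq_one
      intro j _
      exact Pi.mulSingle_eq_of_ne (hb j) _
    have h3 : ∏ j, (Pi.mulSingle b (-1 : ℤˣ) : Fin k → ℤˣ) j = -1 := by
      rw [Finset.prod_eq_single b]
      · simp
      · intro j _ hj
        exact Pi.mulSingle_eq_of_ne hj _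
      · simp
    simp only [Equiv.coe_mulLeft, Pi.mul_apply, Finset.prod_mul_distrib, h2 1, h3] at h
    simp only [one_mul, neg_mul, Units.val_neg, Finset.sum_neg_distrib] at h
    omega

theorem polarization_aux {E F : Type*} [NormedAddCommGroup E] [NormedSpace ℝ E]
    [NormedAddCommGroup F] [NormedSpace ℝ F] (k : ℕ)
    (T : ContinuousMultilinearMap ℝ (fun _ : Fin k => E) F)
    (hsymm : ∀ (v : Fin k → E) (σ : Equiv.Perm (Fin k)), T (v ∘ σ) = T v) (v : Fin k → E) :
    ∑ ε : Fin k → ℤˣ, (((∏ i, ε i : ℤˣ) : ℤ) : ℝ) • T (fun _ => ∑ i, (((ε i : ℤ)) : ℝ) • v i)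
      = ((2 : ℝ) ^ k * (k.factorial : ℝ)) • T v := by
  have h1 : ∀ ε : Fin k → ℤˣ,
      (((∏ i, ε i : ℤˣ) : ℤ) : ℝ) • T (fun _ => ∑ i, (((ε i : ℤ)) : ℝ) • v i)
      = ∑ f : Fin k → Fin k,
        ((((∏ i, ε i) * ∏ j, ε (f j) : ℤˣ) : ℤ) : ℝ) • T (v ∘ f) := by
    intro ε
    rw [T.map_sum (fun _ i => (((ε i : ℤ)) : ℝ) • v i), Finset.smul_sum]
    refine Finset.sum_congr rfl fun f _ => ?_
    rw [T.map_smul_univ (fun j => (((ε (f j) : ℤ)) : ℝ)) (fun j => v (f j)), smul_smul]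
    push_cast
    rfl
  simp only [h1]
  rw [Finset.sum_comm]
  have h2 : ∀ f : Fin k → Fin k,
      ∑ ε : Fin k → ℤˣ, ((((∏ i, ε i) * ∏ j, ε (f j) : ℤˣ) : ℤ) : ℝ) • T (v ∘ f)
      = if Function.Bijective f then ((2 : ℝ) ^ k) • T v else 0 := by
    intro f
    rw [← Finset.sum_smul, ← Int.cast_sum, sign_sum_aux]
    split_ifs with hf
    · rw [← hsymm v (Equiv.ofBijective f hf)]
      simp
    · simp
  simp only [h2]
  rw [← Finset.sum_filter, Finset.sum_const]
  have h3 : (Finset.univ.filter fun f : Fin k → Fin k => Function.Bijective f).card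
      = k.factorial := by
    rw [← Fintype.card_subtype, ← Fintype.card_congr (Equiv.ofBijective
      (fun σ : Equiv.Perm (Fin k) => (⟨σ, σ.bijective⟩ : {f : Fin k → Fin k // Function.Bijective f}))
      ⟨fun a b h => by
        ext x
        exact congrArg (fun g => ((g.1 x : Fin k) : ℕ)) h,
       fun g => ⟨Equiv.ofBijective g.1 g.2, rfl⟩⟩), Fintype.card_perm, Fintype.card_fin]
  rw [h3, ← Nat.cast_smul_eq_nsmul ℝ, smul_smul, mul_comm]

theorem pow_le_exp_aux (n : ℕ) :
    ((n + 1 : ℕ) : ℝ) ^ (n + 1) ≤ Real.exp 1 ^ n * ((n + 1).factorial : ℝ) := by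
  induction n with
  | zero => simp
  | succ n ih =>
    have hp : (0 : ℝ) < ((n + 1 : ℕ) : ℝ) := by positivity
    have h1 : (((n + 1 + 1 : ℕ) : ℝ)) ^ (n + 1) ≤ Real.exp 1 * ((n + 1 : ℕ) : ℝ) ^ (n + 1) := by
      have h2 : ((n + 1 + 1 : ℕ) : ℝ) ≤ Real.exp (((n + 1 : ℕ) : ℝ)⁻¹) * ((n + 1 : ℕ) : ℝ) := by
        have h3 := Real.add_one_le_exp (((n + 1 : ℕ) : ℝ)⁻¹)
        have h4 := mul_le_mul_of_nonneg_right h3 hp.le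
        rw [add_mul, inv_mul_cancel₀ hp.ne'] at h4
        push_cast at h4 ⊢
        linarith
      calc _ ≤ (Real.exp (((n + 1 : ℕ) : ℝ)⁻¹) * ((n + 1 : ℕ) : ℝ)) ^ (n + 1) := by gcongr
        _ = _ := by rw [mul_pow, ← Real.exp_nat_mul, mul_inv_cancel₀ hp.ne']
    rw [pow_succ, Nat.factorial_succ (n + 1), pow_succ (Real.exp 1)]
    calc _ ≤ (Real.exp 1 * ((n + 1 : ℕ) : ℝ) ^ (n + 1)) * ((n + 1 + 1 : ℕ) : ℝ) := by gcongr
      _ ≤ (Real.exp 1 * (Real.exp 1 ^ n * ((n + 1).factorial : ℝ))) * ((n + 1 + 1 : ℕ) : ℝ) := by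
        gcongr
      _ = _ := by push_cast; ring

/-- polarization bound. For a continuous symmetric `k`-linear map `T` (`k ≥ 2`)
with associated polynomial `S(x) = T(x,…,x)`, one has
`‖T‖ ≤ e^(k-1) · sup_{‖x‖ ≤ 1} ‖S(x)‖`. -/
theorem stmt2 {E F : Type*} [NormedAddCommGroup E] [NormedSpace ℝ E]
    [NormedAddCommGroup F] [NormedSpace ℝ F]
    (k : ℕ) (hk : 2 ≤ k)
    (T : ContinuousMultilinearMap ℝ (fun _ : Fin k => E) F)
    (hsymm : ∀ (v : Fin k → E) (σ : Equiv.Perm (Fin k)), T (v ∘ σ) = T v) :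
    ‖T‖ ≤ Real.exp 1 ^ (k - 1) *
      sSup {r : ℝ | ∃ x : E, ‖x‖ ≤ 1 ∧ r = ‖T (fun _ => x)‖} := by
  set A := {r : ℝ | ∃ x : E, ‖x‖ ≤ 1 ∧ r = ‖T (fun _ => x)‖} with hA
  set M := sSup A with hM
  have hbdd : BddAbove A := by
    refine ⟨‖T‖, ?_⟩
    rintro r ⟨x, hx, rfl⟩
    refine (T.le_opNorm _).trans ?_
    refine mul_le_of_le_one_right (norm_nonneg _) ?_
    simpa using pow_le_one₀ (norm_nonneg x) hx
  have hS1 : ∀ x : E, ‖x‖ ≤ 1 → ‖T (fun _ => x)‖ ≤ M := fun x hx => le_csSup hbdd ⟨x, hx, rfl⟩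
  have hM0 : 0 ≤ M := (norm_nonneg _).trans (hS1 0 (by simp))
  have hk0 : (0 : ℝ) < k := by
    have : 0 < k := by omega
    exact_mod_cast this
  have hS : ∀ x : E, ‖x‖ ≤ k → ‖T (fun _ => x)‖ ≤ (k : ℝ) ^ k * M := by
    intro x hx
    have h1 := hS1 ((k : ℝ)⁻¹ • x) (by
      rw [norm_smul, norm_inv, Real.norm_natCast, inv_mul_le_iff₀ hk0]
      simpa using hx)
    have h2 : T (fun _ => x) = (k : ℝ) ^ k • T (fun _ => (k : ℝ)⁻¹ • x) := by
      have h3 := T.map_smul_univ (fun _ => (k : ℝ)) (fun _ => (k : ℝ)⁻¹ • x)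
      simp only [smul_inv_smul₀ hk0.ne', Finset.prod_const, Finset.card_univ, Fintype.card_fin] at h3
      exact h3
    rw [h2, norm_smul, norm_pow, Real.norm_natCast]
    gcongr
  have hunit : ∀ v : Fin k → E, (∀ i, ‖v i‖ = 1) → ‖T v‖ ≤ Real.exp 1 ^ (k - 1) * M := by
    intro v hv
    have hp := polarization_aux k T hsymm v
    have h1 : ‖((2 : ℝ) ^ k * (k.factorial : ℝ)) • T v‖ ≤ 2 ^ k * ((k : ℝ) ^ k * M) := by
      rw [← hp]
      refine (norm_sum_le_of_le _ (f := _) (n := fun _ => (k : ℝ) ^ k * M) ?_).trans ?_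
      · intro ε _
        have habs : ∀ u : ℤˣ, ‖((u : ℤ) : ℝ)‖ = 1 := by
          intro u
          rcases Int.units_eq_one_or u with rfl | rfl <;> simp
        rw [norm_smul, habs, one_mul]
        apply hS
        refine (norm_sum_le _ _).trans ?_
        simp [norm_smul, habs, hv, -Real.norm_eq_abs]
      · simp [Fintype.card_pi]
    rw [norm_smul, Real.norm_of_nonneg (by positivity), mul_assoc] at h1
    have h2 := le_of_mul_le_mul_left h1 (by positivity)
    have h3 := pow_le_exp_aux (k - 1)
    rw [show k - 1 + 1 = k by omega] at h3
    have hf : (0 : ℝ) < (k.factorial : ℝ) := by positivity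
    refine le_of_mul_le_mul_left (h2.trans ?_) hf
    calc _ ≤ (Real.exp 1 ^ (k - 1) * (k.factorial : ℝ)) * M := by gcongr
      _ = _ := by ring
  refine T.opNorm_le_bound (by positivity) fun u => ?_
  by_cases hu : ∃ i, u i = 0
  · obtain ⟨i, hi⟩ := hu
    rw [T.map_coord_zero i hi, norm_zero]
    positivity
  · push Not at hu
    have h1 := T.map_smul_univ (fun i => ‖u i‖) (fun i => ‖u i‖⁻¹ • u i)
    have h2 : (fun i => ‖u i‖ • ‖u i‖⁻¹ • u i) = u := by
      funext i
      exact smul_inv_smul₀ (norm_ne_zero_iff.mpr (hu i)) _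
    rw [h2] at h1
    rw [h1, norm_smul, Real.norm_of_nonneg (by positivity), mul_comm]
    gcongr
    apply hunit
    intro i
    rw [norm_smul, norm_inv, norm_norm, inv_mul_cancel₀ (norm_ne_zero_iff.mpr (hu i))]
end

section
/- Let f : D ⊆ E → F be an analytic map between real Banach spaces and let x, y ∈ D be such that the closed ball of center x and radius ‖y−x‖ is contained in D, Df(x) is invertible, and u := ‖x−y‖·γ(f,x) < 1 − √2/2. Then Df(y) is invertible and ‖Df(y)⁻¹ ∘ Df(x)‖ ≤ (1−u)²/ψ(u). -/
open Filter Metric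

/-- `ψ(u) = 1 - 4u + 2u²`. -/
def psi (u : ℝ) : ℝ := 1 - 4 * u + 2 * u ^ 2

theorem aux_iter_bound {E G : Type*} [NormedAddCommGroup E] [NormedSpace ℝ E]
    [NormedAddCommGroup G] [NormedSpace ℝ G] [CompleteSpace G]
    (g : E → G) (x : E) (hg : AnalyticAt ℝ g x) :
    ∃ M : ℝ, 1 ≤ M ∧ ∀ k : ℕ, 2 ≤ k →
      ‖iteratedFDeriv ℝ k g x‖ / (Nat.factorial k : ℝ) ≤ M ^ k := by
  obtain ⟨p, r, hp⟩ := hg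
  obtain ⟨C, a, hC, ha, hb⟩ := p.le_mul_pow_of_radius_pos (hp.r_pos.trans_le hp.r_le)
  refine ⟨(max C 1) * (max a 1), ?_, ?_⟩
  · nlinarith [le_max_right C 1, le_max_right a 1]
  intro k hk
  have hkf : (0 : ℝ) < (Nat.factorial k : ℝ) := by positivity
  rw [div_le_iff₀ hkf]
  have h1 : ‖iteratedFDeriv ℝ k g x‖ ≤ ‖p k‖ * (Nat.factorial k : ℝ) := by
    refine ContinuousMultilinearMap.opNorm_le_bound (by positivity) ?_
    intro v
    rw [hp.iteratedFDeriv_eq_sum_of_completeSpace]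
    refine (norm_sum_le _ _).trans ?_
    have : ∀ σ ∈ (Finset.univ : Finset (Equiv.Perm (Fin k))),
        ‖p k (fun i ↦ v (σ i))‖ ≤ ‖p k‖ * ∏ i, ‖v i‖ := by
      intro σ _
      refine ((p k).le_opNorm _).trans_eq ?_
      rw [Equiv.prod_comp σ (fun i => ‖v i‖)]
    refine (Finset.sum_le_sum this).trans_eq ?_
    simp [Finset.card_univ, Fintype.card_perm]
    ring
  refine h1.trans ?_
  gcongr
  refine (hb k).trans ?_
  rw [mul_pow]
  gcongr
  · refine (le_max_left C 1).trans ?_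
    exact le_self_pow₀ (le_max_right C 1) (by omega)
  · exact le_max_left a 1

theorem aux_gamma {E F : Type*} [NormedAddCommGroup E] [NormedSpace ℝ E] [CompleteSpace E]
    [NormedAddCommGroup F] [NormedSpace ℝ F]
    (f : E → F) (x : E) (hf : AnalyticAt ℝ f x) (A : E ≃L[ℝ] F) :
    0 ≤ smaleGamma f (A.symm : F →L[ℝ] E) x ∧ ∀ k : ℕ, 2 ≤ k →
      ‖iteratedFDeriv ℝ k (A.symm ∘ f) x‖ / (Nat.factorial k : ℝ) ≤
        smaleGamma f (A.symm : F →L[ℝ] E) x ^ (k - 1) := by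
  have heq : ∀ k : ℕ, (A.symm : F →L[ℝ] E).compContinuousMultilinearMap (iteratedFDeriv ℝ k f x)
      = iteratedFDeriv ℝ k (A.symm ∘ f) x := by
    intro k
    rw [ContinuousLinearEquiv.iteratedFDeriv_comp_left]
  have hg : AnalyticAt ℝ (A.symm ∘ f) x :=
    ((A.symm : F →L[ℝ] E).analyticAt (f x)).comp hf
  obtain ⟨M, hM, hb⟩ := aux_iter_bound _ x hg
  have hterm : ∀ k : ℕ, gammaTerm f (A.symm : F →L[ℝ] E) x k =
      (‖iteratedFDeriv ℝ k (A.symm ∘ f) x‖ / (Nat.factorial k : ℝ)) ^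
        ((1 : ℝ) / ((k : ℝ) - 1)) := by
    intro k
    rw [gammaTerm, heq]
  have hpos : ∀ k : ℕ, 0 ≤ gammaTerm f (A.symm : F →L[ℝ] E) x k := by
    intro k
    rw [gammaTerm]
    positivity
  have hpow : ∀ k : ℕ, 2 ≤ k → gammaTerm f (A.symm : F →L[ℝ] E) x k ^ (k - 1) =
      ‖iteratedFDeriv ℝ k (A.symm ∘ f) x‖ / (Nat.factorial k : ℝ) := by
    intro k hk
    have hk1 : ((k - 1 : ℕ) : ℝ) = (k : ℝ) - 1 := by
      rw [Nat.cast_sub (by omega)]; simp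
    rw [hterm, ← hk1, one_div]
    exact Real.rpow_inv_natCast_pow (by positivity) (by omega)
  have hbdd : BddAbove (gammaSet f (A.symm : F →L[ℝ] E) x) := by
    refine ⟨M ^ 2, ?_⟩
    rintro _ ⟨k, hk, rfl⟩
    have h1 : gammaTerm f (A.symm : F →L[ℝ] E) x k ^ (k - 1) ≤ (M ^ 2) ^ (k - 1) := by
      rw [hpow k hk, ← pow_mul]
      exact (hb k hk).trans (pow_le_pow_right₀ hM (by omega))
    exact le_of_pow_le_pow_left₀ (by omega) (by positivity) h1
  have hle : ∀ k : ℕ, 2 ≤ k →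
      gammaTerm f (A.symm : F →L[ℝ] E) x k ≤ smaleGamma f (A.symm : F →L[ℝ] E) x :=
    fun k hk => le_csSup hbdd ⟨k, hk, rfl⟩
  refine ⟨(hpos 2).trans (hle 2 le_rfl), fun k hk => ?_⟩
  rw [← hpow k hk]
  exact pow_le_pow_left₀ (hpos k) (hle k hk) _

/-- The Taylor series of an analytic map `H` along a segment, under geometric-type bounds. -/
theorem aux_hasSum {E G : Type*} [NormedAddCommGroup E] [NormedSpace ℝ E]
    [NormedAddCommGroup G] [NormedSpace ℝ G] [CompleteSpace G]
    (D : Set E) (H : E → G) (hH : AnalyticOnNhd ℝ H D) (x y : E)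
    (hseg : segment ℝ x y ⊆ D) (c : ℝ) (hc : 0 ≤ c) (hcu : ‖y - x‖ * c < 1)
    (K : ℝ)
    (hb : ∀ n : ℕ, ‖(Nat.factorial n : ℝ)⁻¹ • iteratedFDeriv ℝ n H x‖ ≤ K * (n + 1) * c ^ n) :
    HasSum (fun n : ℕ => ((Nat.factorial n : ℝ)⁻¹ • iteratedFDeriv ℝ n H x) (fun _ => y - x))
      (H y) := by
  set q : FormalMultilinearSeries ℝ E G :=
    fun n => (Nat.factorial n : ℝ)⁻¹ • iteratedFDeriv ℝ n H x with hq
  obtain ⟨r, hr1, hr2⟩ : ∃ r : ℝ, ‖y - x‖ < r ∧ r * c < 1 := by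
    have h1 : 0 < (1 - ‖y - x‖ * c) / (2 * (c + 1)) := by
      apply div_pos <;> linarith
    refine ⟨‖y - x‖ + (1 - ‖y - x‖ * c) / (2 * (c + 1)), by linarith, ?_⟩
    have h2 : (1 - ‖y - x‖ * c) / (2 * (c + 1)) * (2 * (c + 1)) = 1 - ‖y - x‖ * c := by
      field_simp
    nlinarith
  have hr0 : 0 ≤ r := (norm_nonneg _).trans hr1.le
  have hrad : ENNReal.ofReal r ≤ q.radius := by
    refine q.le_radius_of_summable_norm (r := r.toNNReal) ?_
    have hs : Summable (fun n : ℕ => K * (((n + 1).choose 1 : ℕ) * (r * c) ^ n : ℝ)) := by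
      refine Summable.mul_left _ (hasSum_choose_mul_geometric_of_norm_lt_one 1 ?_).summable
      rw [Real.norm_eq_abs, abs_of_nonneg (by positivity)]
      exact hr2
    refine Summable.of_nonneg_of_le (fun n => by positivity) (fun n => ?_) hs
    rw [Real.coe_toNNReal r hr0]
    calc ‖q n‖ * r ^ n ≤ (K * (n + 1) * c ^ n) * r ^ n := by gcongr; exact hb n
      _ = _ := by simp [mul_pow]; ring
  have hr3 : 0 < r := (norm_nonneg _).trans_lt hr1
  have hqr : 0 < q.radius := (ENNReal.ofReal_pos.2 hr3).trans_le hrad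
  have hQ : HasFPowerSeriesOnBall (fun z => q.sum (z - x)) q x q.radius := by
    simpa using (q.hasFPowerSeriesOnBall hqr).comp_sub x
  have hmem : ∀ z : E, ‖z - x‖ ≤ ‖y - x‖ → z ∈ Metric.eball x q.radius := by
    intro z hz
    rw [Metric.mem_eball, edist_dist, dist_eq_norm]
    exact ((ENNReal.ofReal_lt_ofReal_iff hr3).2 (hz.trans_lt hr1)).trans_le hrad
  have hxs := left_mem_segment ℝ x y
  have hys := right_mem_segment ℝ x y
  have hQa : AnalyticOnNhd ℝ (fun z => q.sum (z - x)) (segment ℝ x y) := by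
    intro z hz
    refine hQ.analyticAt_of_mem (hmem z ?_)
    rw [segment_eq_image'] at hz
    obtain ⟨t, ht, rfl⟩ := hz
    simp only [add_sub_cancel_left, norm_smul, Real.norm_eq_abs, abs_of_nonneg ht.1]
    nlinarith [norm_nonneg (y - x), ht.2]
  have hev : H =ᶠ[nhds x] (fun z => q.sum (z - x)) := by
    obtain ⟨p, s, hp⟩ := hH x (hseg hxs)
    filter_upwards [Metric.eball_mem_nhds x hp.r_pos, Metric.eball_mem_nhds x hqr] with z hz hz'
    have hz1 : z - x ∈ Metric.eball (0 : E) s := by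
      simpa [Metric.mem_eball, edist_eq_enorm_sub] using hz
    have h1 := hp.hasSum_iteratedFDeriv hz1
    rw [add_sub_cancel] at h1
    refine h1.unique ?_
    have hz2 : z - x ∈ Metric.eball (0 : E) q.radius := by
      simpa [Metric.mem_eball, edist_eq_enorm_sub] using hz'
    have h2 := q.hasSum hz2
    simpa [hq] using h2
  have hEq := (hH.mono hseg).eqOn_of_preconnected_of_eventuallyEq hQa
    (convex_segment x y).isPreconnected hxs hev hys
  rw [hEq]
  refine q.hasSum ?_
  have := hmem y le_rfl
  simpa [Metric.mem_eball, edist_eq_enorm_sub] using this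

/-- if `u = ‖x - y‖ · γ(f, x) < 1 - √2/2` then `Df(y)` is invertible and
`‖Df(y)⁻¹ ∘ Df(x)‖ ≤ (1-u)²/ψ(u)`. -/
theorem stmt3 {E F : Type*} [NormedAddCommGroup E] [NormedSpace ℝ E] [CompleteSpace E]
    [NormedAddCommGroup F] [NormedSpace ℝ F] [CompleteSpace F]
    (D : Set E) (hD : IsOpen D) (f : E → F) (hf : AnalyticOnNhd ℝ f D)
    (x y : E) (hx : x ∈ D) (hy : y ∈ D)
    (hball : Metric.closedBall x ‖y - x‖ ⊆ D)
    (A : E ≃L[ℝ] F) (hA : (A : E →L[ℝ] F) = fderiv ℝ f x)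
    (u : ℝ) (hu : u = ‖x - y‖ * smaleGamma f (A.symm : F →L[ℝ] E) x)
    (hult : u < 1 - Real.sqrt 2 / 2) :
    ∃ B : E ≃L[ℝ] F, (B : E →L[ℝ] F) = fderiv ℝ f y ∧
      ‖(B.symm : F →L[ℝ] E).comp (A : E →L[ℝ] F)‖ ≤ (1 - u) ^ 2 / psi u := by
  obtain ⟨hγ0, hγ⟩ := aux_gamma f x (hf x hx) A
  set γ := smaleGamma f (A.symm : F →L[ℝ] E) x with hγdef
  rw [norm_sub_rev] at hu
  have hu0 : 0 ≤ u := by rw [hu]; positivity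
  have h2 : Real.sqrt 2 ^ 2 = 2 := Real.sq_sqrt (by norm_num)
  have hs0 : 0 < Real.sqrt 2 := by positivity
  have hu1 : u < 1 := by linarith
  have hψ : 0 < psi u := by unfold psi; nlinarith
  set H : E → (E →L[ℝ] E) := fderiv ℝ (A.symm ∘ f) with hHdef
  have hHz : ∀ z, H z = (A.symm : F →L[ℝ] E).comp (fderiv ℝ f z) := by
    intro z
    exact A.symm.comp_fderiv
  have hga : AnalyticOnNhd ℝ (A.symm ∘ f) D := fun z hz =>
    ((A.symm : F →L[ℝ] E).analyticAt (f z)).comp (hf z hz)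
  have hHa : AnalyticOnNhd ℝ H D := hga.fderiv
  have hHx : H x = ContinuousLinearMap.id ℝ E := by
    rw [hHz, ← hA]; ext v; simp
  have hseg : segment ℝ x y ⊆ D := by
    refine Set.Subset.trans ?_ hball
    refine (convex_closedBall x _).segment_subset ?_ ?_
    · simp
    · simp [dist_eq_norm]
  have hb : ∀ n : ℕ, ‖(Nat.factorial n : ℝ)⁻¹ • iteratedFDeriv ℝ n H x‖ ≤
      1 * (n + 1) * γ ^ n := by
    intro n
    rw [norm_smul, norm_iteratedFDeriv_fderiv, norm_inv, Real.norm_natCast]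
    rcases Nat.eq_zero_or_pos n with rfl | hn
    · have h0 : ‖iteratedFDeriv ℝ (0 + 1) (A.symm ∘ f) x‖ = ‖H x‖ := by
        rw [← norm_iteratedFDeriv_fderiv, norm_iteratedFDeriv_zero]
      rw [h0, hHx]
      simpa using ContinuousLinearMap.norm_id_le
    · have h1 := hγ (n + 1) (by omega)
      rw [div_le_iff₀ (by positivity), Nat.factorial_succ] at h1
      rw [inv_mul_le_iff₀ (by positivity)]
      refine h1.trans_eq ?_
      push_cast
      simp
      ring
  have hsum := aux_hasSum D H hHa x y hseg γ hγ0 (by linarith) 1 hb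
  have hgeo : HasSum (fun n : ℕ => ((n : ℝ) + 1) * u ^ n) (1 / (1 - u) ^ 2) := by
    have := hasSum_choose_mul_geometric_of_norm_lt_one (𝕜 := ℝ) 1 (r := u)
      (by rwa [Real.norm_eq_abs, abs_of_nonneg hu0])
    simpa using this
  have hsum1 := (hasSum_nat_add_iff' 1).2 hsum
  have hgeo1 := (hasSum_nat_add_iff' 1).2 hgeo
  have hT : ‖H y - ContinuousLinearMap.id ℝ E‖ ≤ 1 / (1 - u) ^ 2 - 1 := by
    have h3 : ‖∑' n : ℕ, ((Nat.factorial (n + 1) : ℝ)⁻¹ • iteratedFDeriv ℝ (n + 1) H x)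
        (fun _ => y - x)‖ ≤ _ := tsum_of_norm_bounded hgeo1 (fun n => by
      refine (ContinuousMultilinearMap.le_opNorm _ _).trans ?_
      have := hb (n + 1)
      simp only [Finset.prod_const, Finset.card_univ, Fintype.card_fin]
      rw [hu, mul_pow]
      calc _ ≤ (1 * (((n + 1 : ℕ) : ℝ) + 1) * γ ^ (n + 1)) * ‖y - x‖ ^ (n + 1) := by gcongr
        _ = _ := by ring)
    rw [hsum1.tsum_eq] at h3
    simpa [hHx] using h3
  set t : E →L[ℝ] E := 1 - H y with ht
  have htn : ‖t‖ ≤ 1 / (1 - u) ^ 2 - 1 := by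
    rw [ht, norm_sub_rev]; exact hT
  have h1u : 0 < (1 - u) ^ 2 := by have : 0 < 1 - u := by linarith
                                   positivity
  have hlt : 1 / (1 - u) ^ 2 - 1 < 1 := by
    rw [sub_lt_iff_lt_add, div_lt_iff₀ h1u]
    unfold psi at hψ
    nlinarith
  let U : (E →L[ℝ] E)ˣ := Units.oneSub t (htn.trans_lt hlt)
  have hU : (U : E →L[ℝ] E) = H y := by
    simp [U, ht]
  let L : E ≃L[ℝ] E := ContinuousLinearEquiv.ofUnit U
  have hL : (L : E →L[ℝ] E) = H y := by
    rw [← hU]; rfl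
  refine ⟨L.trans A, ?_, ?_⟩
  · ext v
    have : L v = A.symm (fderiv ℝ f y v) := by
      have := congrArg (fun T : E →L[ℝ] E => T v) (hL.trans (hHz y))
      simpa using this
    simp [this]
  · have hW : ((L.trans A).symm : F →L[ℝ] E).comp (A : E →L[ℝ] F) = (U⁻¹ : (E →L[ℝ] E)ˣ) := by
      ext v
      simp only [ContinuousLinearMap.comp_apply, ContinuousLinearEquiv.coe_coe,
        ContinuousLinearEquiv.symm_trans_apply, ContinuousLinearEquiv.symm_apply_apply]
      rfl
    rw [hW]
    set w : E →L[ℝ] E := ((U⁻¹ : (E →L[ℝ] E)ˣ) : E →L[ℝ] E) with hw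
    have hmul : (1 - t) * w = 1 := by
      have : (1 - t) = (U : E →L[ℝ] E) := by rw [hU, ht]; abel
      rw [this, hw, Units.mul_inv]
    have hweq : w = 1 + t * w := by
      rw [← hmul]; noncomm_ring
    have hn : ‖w‖ ≤ 1 + ‖t‖ * ‖w‖ := by
      calc ‖w‖ = ‖1 + t * w‖ := by rw [← hweq]
        _ ≤ ‖(1 : E →L[ℝ] E)‖ + ‖t * w‖ := norm_add_le _ _
        _ ≤ 1 + ‖t‖ * ‖w‖ := add_le_add ContinuousLinearMap.norm_id_le (norm_mul_le _ _)
    have hn2 : ‖w‖ ≤ 1 + (1 / (1 - u) ^ 2 - 1) * ‖w‖ :=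
      hn.trans (by gcongr)
    rw [le_div_iff₀ hψ]
    have h5 : 1 / (1 - u) ^ 2 * (1 - u) ^ 2 = 1 := one_div_mul_cancel h1u.ne'
    have h6 := mul_le_mul_of_nonneg_right hn2 h1u.le
    have h7 : (1 + (1 / (1 - u) ^ 2 - 1) * ‖w‖) * (1 - u) ^ 2 =
      (1 - u) ^ 2 + ‖w‖ * (1 / (1 - u) ^ 2 * (1 - u) ^ 2) - ‖w‖ * (1 - u) ^ 2 := by ring
    rw [h7, h5] at h6
    unfold psi
    nlinarith
end

section
/- Let f : D ⊆ E → F be an analytic map between real Banach spaces and let x, y ∈ D be such that the closed ball of center x and radius ‖y−x‖ is contained in D, Df(x) is invertible, and u := γ(f,x)·‖x−y‖ ≤ 1 − √2/2 with ψ(u) > 0. Then Df(y) is invertible and γ(f,y) ≤ γ(f,x) / ((1−u)·ψ(u)). -/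
open Filter Metric

section aux
variable {E G : Type*} [NormedAddCommGroup E] [NormedSpace ℝ E]
    [NormedAddCommGroup G] [NormedSpace ℝ G]

/-- The normalised Taylor series. -/
noncomputable def taylorS (h : E → G) (x : E) : FormalMultilinearSeries ℝ E G :=
  fun n => ((n.factorial : ℝ)⁻¹) • iteratedFDeriv ℝ n h x

lemma aux_norm_iter [CompleteSpace G] {h : E → G} {p : FormalMultilinearSeries ℝ E G} {x : E}
    (hp : HasFPowerSeriesAt h p x) (n : ℕ) :
    ‖iteratedFDeriv ℝ n h x‖ ≤ n.factorial * ‖p n‖ := by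
  obtain ⟨r, hr⟩ := hp
  refine ContinuousMultilinearMap.opNorm_le_bound (by positivity) fun v => ?_
  rw [hr.iteratedFDeriv_eq_sum_of_completeSpace]
  refine (norm_sum_le _ _).trans ?_
  have : ∀ σ ∈ (Finset.univ : Finset (Equiv.Perm (Fin n))),
      ‖p n (fun i => v (σ i))‖ ≤ ‖p n‖ * ∏ i, ‖v i‖ := by
    intro σ _
    refine ((p n).le_opNorm _).trans_eq ?_
    congr 1
    exact Equiv.prod_comp σ (fun i => ‖v i‖)
  refine (Finset.sum_le_card_nsmul _ _ _ this).trans_eq ?_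
  simp [Fintype.card_perm, mul_assoc]

lemma aux_norm_taylor_eq (h : E → G) (x : E) (n : ℕ) :
    ‖taylorS h x n‖ = ‖iteratedFDeriv ℝ n h x‖ / n.factorial := by
  rw [taylorS, norm_smul, norm_inv, div_eq_inv_mul]
  simp

lemma aux_norm_taylor [CompleteSpace G] {h : E → G} {p : FormalMultilinearSeries ℝ E G} {x : E}
    (hp : HasFPowerSeriesAt h p x) (n : ℕ) :
    ‖taylorS h x n‖ ≤ ‖p n‖ := by
  rw [aux_norm_taylor_eq, div_le_iff₀ (by positivity), mul_comm]
  exact aux_norm_iter hp n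

lemma aux_taylor [CompleteSpace G] {h : E → G} {x : E} (hp : AnalyticAt ℝ h x) :
    HasFPowerSeriesAt h (taylorS h x) x := by
  obtain ⟨p, r, hr⟩ := hp
  refine ⟨r, ?_, hr.r_pos, ?_⟩
  · refine hr.r_le.trans ?_
    refine ENNReal.le_of_forall_nnreal_lt fun s hs => ?_
    obtain ⟨C, hC, hb⟩ := p.norm_mul_pow_le_of_lt_radius hs
    refine FormalMultilinearSeries.le_radius_of_bound _ C fun n => ?_
    exact (mul_le_mul_of_nonneg_right (aux_norm_taylor hr.hasFPowerSeriesAt n)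
      (by positivity)).trans (hb n)
  · intro y hy
    exact hr.hasSum_iteratedFDeriv hy

lemma aux_transport [CompleteSpace E] [CompleteSpace G] {D : Set E} (hD : IsOpen D) {h : E → G}
    (hh : AnalyticOnNhd ℝ h D) {x y : E} (hball : Metric.closedBall x ‖y - x‖ ⊆ D)
    (hr : (‖y - x‖₊ : ENNReal) < (taylorS h x).radius) :
    HasFPowerSeriesAt h ((taylorS h x).changeOrigin (y - x)) y := by
  set q := taylorS h x with hq
  have hxD : x ∈ D := hball (Metric.mem_closedBall_self (norm_nonneg _))
  have hpos : 0 < q.radius := lt_of_le_of_lt (zero_le) hr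
  have hs0 : HasFPowerSeriesOnBall (fun z => q.sum (z - x)) q x q.radius := by
    simpa using (q.hasFPowerSeriesOnBall hpos).comp_sub x
  set V := D ∩ Metric.eball x q.radius with hV
  have hVo : IsOpen V := hD.inter Metric.isOpen_eball
  set W := connectedComponentIn V x with hW
  have hWo : IsOpen W := hVo.connectedComponentIn
  have hsub : Metric.closedBall x ‖y - x‖ ⊆ V := by
    intro z hz
    refine ⟨hball hz, ?_⟩
    rw [Metric.mem_eball]
    refine lt_of_le_of_lt ?_ hr
    rw [Metric.mem_closedBall, dist_eq_norm] at hz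
    rw [edist_eq_enorm_sub, enorm_eq_nnnorm]
    exact_mod_cast hz
  have hsubW : Metric.closedBall x ‖y - x‖ ⊆ W :=
    (convex_closedBall x _).isPreconnected.subset_connectedComponentIn
      (Metric.mem_closedBall_self (norm_nonneg _)) hsub
  have hyW : y ∈ W := hsubW (by simp [dist_eq_norm])
  have hxW : x ∈ W := hsubW (Metric.mem_closedBall_self (norm_nonneg _))
  have hWV : W ⊆ V := connectedComponentIn_subset _ _
  have heq : Set.EqOn h (fun z => q.sum (z - x)) W := by
    refine AnalyticOnNhd.eqOn_of_preconnected_of_eventuallyEq (𝕜 := ℝ)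
      (hh.mono (hWV.trans Set.inter_subset_left))
      (hs0.analyticOnNhd.mono (hWV.trans Set.inter_subset_right))
      isPreconnected_connectedComponentIn hxW ?_
    obtain ⟨r, hr'⟩ := aux_taylor (hh x hxD)
    have h1 : ∀ᶠ z in nhds x, z ∈ Metric.eball x (min r q.radius) :=
      Metric.isOpen_eball.mem_nhds (Metric.mem_eball_self (lt_min hr'.r_pos hpos))
    filter_upwards [h1] with z hz
    have hz1 : z ∈ Metric.eball x r := Metric.eball_subset_eball (min_le_left _ _) hz
    have hz2 : z ∈ Metric.eball x q.radius := Metric.eball_subset_eball (min_le_right _ _) hz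
    exact (hr'.hasSum_sub hz1).unique (hs0.hasSum_sub hz2)
  have hc := (hs0.changeOrigin (y := y - x) hr).hasFPowerSeriesAt
  rw [add_sub_cancel] at hc
  refine hc.congr ?_
  filter_upwards [hWo.mem_nhds hyW] with z hz
  exact (heq hz).symm

lemma aux_change (p : FormalMultilinearSeries ℝ E G) (z : E) (k : ℕ) (c : ℕ → ℝ) (a : ℝ)
    (hc : ∀ l, ‖p (k + l)‖ ≤ c l)
    (hs : HasSum (fun l => ((l + k).choose k : ℝ) * c l * ‖z‖ ^ l) a) :
    ‖p.changeOrigin z k‖ ≤ a := by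
  refine tsum_of_norm_bounded hs fun l => ?_
  have h := p.nnnorm_changeOriginSeries_apply_le_tsum k l z
  rw [tsum_fintype, Finset.sum_const, Finset.card_univ] at h
  have hcard : Fintype.card { s : Finset (Fin (k + l)) // s.card = l } = (l + k).choose k := by
    rw [Fintype.card_finset_len, Fintype.card_fin, add_comm l k, Nat.choose_symm_add]
  rw [hcard] at h
  have h' : ‖p.changeOriginSeries k l fun _ => z‖ ≤
      ((l + k).choose k : ℝ) * (‖p (k + l)‖ * ‖z‖ ^ l) := by
    have := NNReal.coe_le_coe.2 h
    simpa using this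
  refine h'.trans ?_
  rw [mul_assoc]
  gcongr
  exact hc l

/-- main estimate for a function with vanishing derivative -/
lemma aux_main [CompleteSpace E] [CompleteSpace G] {D : Set E} (hD : IsOpen D) {h : E → G}
    (hh : AnalyticOnNhd ℝ h D) {x y : E} (hball : Metric.closedBall x ‖y - x‖ ⊆ D)
    {g : ℝ} (hg : 0 ≤ g) (hu : g * ‖y - x‖ < 1)
    (h1 : fderiv ℝ h x = 0)
    (h2 : ∀ k, 2 ≤ k → ‖iteratedFDeriv ℝ k h x‖ / k.factorial ≤ g ^ (k - 1)) :
    ‖fderiv ℝ h y‖ ≤ 1 / (1 - g * ‖y - x‖) ^ 2 - 1 ∧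
    ∀ k, 2 ≤ k → ‖iteratedFDeriv ℝ k h y‖ / k.factorial ≤
      g ^ (k - 1) / (1 - g * ‖y - x‖) ^ (k + 1) := by
  set t := ‖y - x‖ with ht
  have ht0 : 0 ≤ t := norm_nonneg _
  have hq1 : ‖taylorS h x 1‖ = 0 := by
    rw [aux_norm_taylor_eq, norm_iteratedFDeriv_one, h1]; simp
  have hqb : ∀ k, 1 ≤ k → ‖taylorS h x k‖ ≤ g ^ (k - 1) := by
    intro k hk
    rcases hk.eq_or_lt with rfl | hk
    · rw [hq1]; positivity
    · rw [aux_norm_taylor_eq]; exact h2 k hk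
  have hrad : (‖y - x‖₊ : ENNReal) < (taylorS h x).radius := by
    obtain ⟨s, hs1, hs2⟩ : ∃ s : ℝ, t < s ∧ g * s < 1 := by
      have hct : ContinuousAt (fun s : ℝ => g * s) t := by fun_prop
      have := (hct.eventually_lt continuousAt_const hu)
      obtain ⟨ε, hε, hb⟩ := Metric.eventually_nhds_iff.1 this
      refine ⟨t + ε / 2, by linarith, hb ?_⟩
      rw [Real.dist_eq, add_sub_cancel_left, abs_of_pos (by linarith)]; linarith
    have hs0 : 0 ≤ s := ht0.trans hs1.le
    lift s to NNReal using hs0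
    refine lt_of_lt_of_le (b := (s : ENNReal)) ?_ ?_
    · rw [ENNReal.coe_lt_coe, ← NNReal.coe_lt_coe]; exact hs1
    · refine FormalMultilinearSeries.le_radius_of_bound _ (max ‖taylorS h x 0‖ (s : ℝ)) fun n => ?_
      rcases n with _ | n
      · simp
      · refine le_trans ?_ (le_max_right _ _)
        have := hqb (n + 1) (by omega)
        calc ‖taylorS h x (n + 1)‖ * s ^ (n + 1) ≤ g ^ n * s ^ (n + 1) := by
              gcongr; simpa using this
          _ = (g * s) ^ n * s := by ring
          _ ≤ 1 * s := by
              gcongr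
              exact pow_le_one₀ (by positivity) hs2.le
          _ = s := one_mul _
  have hy := aux_transport hD hh hball hrad
  have hu0 : 0 ≤ g * t := by positivity
  have hnorm : ‖g * t‖ < 1 := by rwa [Real.norm_of_nonneg hu0]
  constructor
  · have := aux_norm_iter hy 1
    rw [norm_iteratedFDeriv_one] at this
    refine this.trans ?_
    simp only [Nat.factorial_one, Nat.cast_one, one_mul]
    refine aux_change _ _ 1 (fun l => if l = 0 then 0 else g ^ l) _ ?_ ?_
    · intro l
      rcases l with _ | l
      · simp [hq1]
      · have := hqb (1 + (l + 1)) (by omega)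
        simpa using this
    · have hs := hasSum_choose_mul_geometric_of_norm_lt_one 1 hnorm
      have hs' := hs.sub (hasSum_ite_eq (0 : ℕ) (1 : ℝ))
      refine (congrArg (fun F => HasSum F _) (funext fun l => ?_)).mpr hs'
      rcases l with _ | l
      · simp
      · simp [mul_pow, mul_assoc, ht]
  · intro k hk
    rw [div_le_iff₀ (by positivity), mul_comm]
    refine (aux_norm_iter hy k).trans ?_
    gcongr
    refine aux_change _ _ k (fun l => g ^ (k + l - 1)) _ (fun l => hqb _ (by omega)) ?_
    have hs := (hasSum_choose_mul_geometric_of_norm_lt_one k hnorm).mul_left (g ^ (k - 1))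
    rw [mul_one_div] at hs
    refine (congrArg (fun F => HasSum F _) (funext fun l => ?_)).mpr hs
    have : k + l - 1 = (k - 1) + l := by omega
    rw [this, pow_add, mul_pow, ht]; ring

lemma aux_gammaTerm_le {f : E → G} {L : G →L[ℝ] E} {x : E} {k : ℕ} (hk : 2 ≤ k) {M : ℝ}
    (hM : 0 ≤ M) :
    gammaTerm f L x k ≤ M ↔
      ‖L.compContinuousMultilinearMap (iteratedFDeriv ℝ k f x)‖ / (Nat.factorial k : ℝ)
        ≤ M ^ (k - 1) := by
  have hk' : ((k - 1 : ℕ) : ℝ) = (k : ℝ) - 1 := by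
    rw [Nat.cast_sub (by omega)]; simp
  have hpos : (0 : ℝ) < (k : ℝ) - 1 := by
    rw [← hk']; exact_mod_cast (by omega : 0 < k - 1)
  rw [gammaTerm, one_div, Real.rpow_inv_le_iff_of_pos (by positivity) hM hpos, ← hk',
    Real.rpow_natCast]

lemma aux_iter_id {k : ℕ} (hk : 2 ≤ k) (z : E) : iteratedFDeriv ℝ k (fun w : E => w) z = 0 := by
  obtain ⟨n, rfl⟩ : ∃ n, k = n + 1 := ⟨k - 1, by omega⟩
  rw [← norm_eq_zero, ← norm_iteratedFDeriv_fderiv]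
  have : fderiv ℝ (fun w : E => w) = fun _ => ContinuousLinearMap.id ℝ E := by
    funext w; exact fderiv_fun_id
  rw [this, iteratedFDeriv_const_of_ne (by omega)]
  simp

lemma aux_iter_h {f : E → G} {z : E} (hf : AnalyticAt ℝ f z) [CompleteSpace G] (L : G →L[ℝ] E)
    {k : ℕ} (hk : 2 ≤ k) :
    iteratedFDeriv ℝ k (fun w => L (f w) - w) z =
      L.compContinuousMultilinearMap (iteratedFDeriv ℝ k f z) := by
  have hc : ContDiffAt ℝ k f z := hf.contDiffAt
  have h1 : ContDiffAt ℝ k (fun w => L (f w)) z := L.contDiff.contDiffAt.comp z hc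
  have h2 : ContDiffAt ℝ k (fun w : E => w) z := contDiffAt_id
  rw [fun_iteratedFDeriv_sub_apply h1 h2, aux_iter_id hk, sub_zero]
  exact L.iteratedFDeriv_comp_left hc le_rfl

end aux

/-- if `u = γ(f,x) · ‖x - y‖ ≤ 1 - √2/2` and `ψ(u) > 0` then `Df(y)` is
invertible and `γ(f, y) ≤ γ(f, x) / ((1-u)·ψ(u))` (in particular `γ(f,y)` is finite). -/
theorem stmt4 {E F : Type*} [NormedAddCommGroup E] [NormedSpace ℝ E] [CompleteSpace E]
    [NormedAddCommGroup F] [NormedSpace ℝ F] [CompleteSpace F]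
    (D : Set E) (hD : IsOpen D) (f : E → F) (hf : AnalyticOnNhd ℝ f D)
    (x y : E) (hx : x ∈ D) (hy : y ∈ D)
    (hball : Metric.closedBall x ‖y - x‖ ⊆ D)
    (A : E ≃L[ℝ] F) (hA : (A : E →L[ℝ] F) = fderiv ℝ f x)
    (u : ℝ) (hu : u = smaleGamma f (A.symm : F →L[ℝ] E) x * ‖x - y‖)
    (hule : u ≤ 1 - Real.sqrt 2 / 2) (hψ : 0 < psi u) :
    ∃ B : E ≃L[ℝ] F, (B : E →L[ℝ] F) = fderiv ℝ f y ∧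
      BddAbove (gammaSet f (B.symm : F →L[ℝ] E) y) ∧
      smaleGamma f (B.symm : F →L[ℝ] E) y ≤
        smaleGamma f (A.symm : F →L[ℝ] E) x / ((1 - u) * psi u) := by
  set γ := smaleGamma f (A.symm : F →L[ℝ] E) x with hγ
  have hγ0 : 0 ≤ γ := by
    refine Real.sSup_nonneg ?_
    rintro _ ⟨k, hk, rfl⟩
    exact Real.rpow_nonneg (by positivity) _
  set L : F →L[ℝ] E := (A.symm : F →L[ℝ] E) with hL
  set h : E → E := fun w => L (f w) - w with hh
  have hhan : AnalyticOnNhd ℝ h D := fun z hz =>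
    (L.analyticAt _ |>.comp (hf z hz)).sub analyticAt_id
  -- boundedness at x
  have hbdd : BddAbove (gammaSet f L x) := by
    have hp := aux_taylor (hhan x hx)
    obtain ⟨r, hr0, hr⟩ := ENNReal.lt_iff_exists_nnreal_btwn.1 hp.radius_pos
    have hr0' : 0 < r := by exact_mod_cast hr0
    obtain ⟨C, hC, hb⟩ := (taylorS h x).norm_le_div_pow_of_pos_of_lt_radius hr0' hr
    have hr1 : (0 : ℝ) < r := hr0'
    refine ⟨max 1 (C / r) * (1 / r), ?_⟩
    rintro _ ⟨k, hk, rfl⟩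
    rw [aux_gammaTerm_le hk (by positivity), ← aux_iter_h (hf x hx) L hk, ← aux_norm_taylor_eq]
    refine (hb k).trans ?_
    obtain ⟨n, rfl⟩ : ∃ n, k = n + 1 := ⟨k - 1, by omega⟩
    rw [Nat.add_sub_cancel, mul_pow]
    calc C / (r : ℝ) ^ (n + 1) = (C / r) * (1 / r) ^ n := by
          rw [pow_succ, one_div, inv_pow]; field_simp
      _ ≤ (max 1 (C / r)) ^ n * (1 / r) ^ n := by
          gcongr
          exact (le_max_right _ _).trans (le_self_pow₀ (le_max_left _ _) (by omega))
  have hγk : ∀ k, 2 ≤ k → ‖iteratedFDeriv ℝ k h x‖ / k.factorial ≤ γ ^ (k - 1) := by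
    intro k hk
    rw [hh, aux_iter_h (hf x hx) L hk, ← aux_gammaTerm_le hk hγ0]
    exact le_csSup hbdd ⟨k, hk, rfl⟩
  have hfd : ∀ z ∈ D, fderiv ℝ h z = L.comp (fderiv ℝ f z) - ContinuousLinearMap.id ℝ E := by
    intro z hz
    have h1 := (hf z hz).differentiableAt.hasFDerivAt
    exact ((L.hasFDerivAt.comp z h1).sub (hasFDerivAt_id z)).fderiv
  have hfdx : fderiv ℝ h x = 0 := by
    rw [hfd x hx, ← hA]
    ext v
    simp [hL]
  rw [norm_sub_rev] at hu
  have hs2 : (1 : ℝ) < Real.sqrt 2 := by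
    rw [Real.lt_sqrt (by norm_num)]; norm_num
  have hu0 : 0 ≤ u := by rw [hu]; positivity
  have hu1 : u < 1 := by linarith
  obtain ⟨hK, hDk⟩ := aux_main hD hhan hball hγ0 (hu ▸ hu1) hfdx hγk
  rw [← hu] at hK
  simp only [← hu] at hDk
  have h1u : 0 < 1 - u := by linarith
  have hψe : psi u = 2 * (1 - u) ^ 2 - 1 := by unfold psi; ring
  have hψ1 : psi u ≤ 1 := by rw [hψe]; nlinarith
  set K := fderiv ℝ h y with hKdef
  have hK2 : psi u / (1 - u) ^ 2 ≤ 1 - ‖K‖ := by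
    have : psi u / (1 - u) ^ 2 = 2 - 1 / (1 - u) ^ 2 := by
      rw [hψe]; field_simp
    linarith
  have hKpos : 0 < 1 - ‖K‖ := lt_of_lt_of_le (by positivity) hK2
  have hK1 : ‖-K‖ < 1 := by rw [norm_neg]; linarith
  set U : (E →L[ℝ] E)ˣ := Units.oneSub (-K) hK1 with hU
  have hUval : (U : E →L[ℝ] E) = 1 + K := by
    rw [hU, Units.val_oneSub, sub_neg_eq_add]
  have hUinv : ‖(↑U⁻¹ : E →L[ℝ] E)‖ ≤ (1 - u) ^ 2 / psi u := by
    have e : (↑U⁻¹ : E →L[ℝ] E) = 1 - K * ↑U⁻¹ := by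
      have := U.mul_inv
      rw [hUval, add_mul, one_mul] at this
      exact eq_sub_of_add_eq this
    have n1 : ‖(↑U⁻¹ : E →L[ℝ] E)‖ ≤ 1 + ‖K‖ * ‖(↑U⁻¹ : E →L[ℝ] E)‖ := by
      calc ‖(↑U⁻¹ : E →L[ℝ] E)‖ = ‖1 - K * ↑U⁻¹‖ := by rw [← e]
        _ ≤ ‖(1 : E →L[ℝ] E)‖ + ‖K * ↑U⁻¹‖ := norm_sub_le _ _
        _ ≤ _ := add_le_add ContinuousLinearMap.norm_id_le (norm_mul_le _ _)
    have n2 : ‖(↑U⁻¹ : E →L[ℝ] E)‖ * (psi u / (1 - u) ^ 2) ≤ 1 := by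
      have := mul_le_mul_of_nonneg_left hK2 (norm_nonneg (↑U⁻¹ : E →L[ℝ] E))
      linarith
    rw [mul_div_assoc', div_le_one (by positivity)] at n2
    rw [le_div_iff₀ hψ]; exact n2
  set B : E ≃L[ℝ] F := (ContinuousLinearEquiv.ofUnit U).trans A with hB
  have hBsymm : (B.symm : F →L[ℝ] E) = (↑U⁻¹ : E →L[ℝ] E).comp L := by
    ext v; rfl
  have hBy : (B : E →L[ℝ] F) = fderiv ℝ f y := by
    have e1 : (B : E →L[ℝ] F) = (A : E →L[ℝ] F).comp (U : E →L[ℝ] E) := by ext v; rfl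
    rw [e1, hUval, hKdef, hfd y hy]
    ext v
    simp [hL]
  have hM0 : 0 ≤ γ / ((1 - u) * psi u) := by positivity
  have hbound : ∀ g ∈ gammaSet f (B.symm : F →L[ℝ] E) y, g ≤ γ / ((1 - u) * psi u) := by
    rintro _ ⟨k, hk, rfl⟩
    rw [aux_gammaTerm_le hk hM0]
    have e2 : (B.symm : F →L[ℝ] E).compContinuousMultilinearMap (iteratedFDeriv ℝ k f y) =
        (↑U⁻¹ : E →L[ℝ] E).compContinuousMultilinearMap (iteratedFDeriv ℝ k h y) := by
      rw [hh, aux_iter_h (hf y hy) L hk, hBsymm]; rfl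
    rw [e2]
    have e3 := ContinuousLinearMap.norm_compContinuousMultilinearMap_le
      (↑U⁻¹ : E →L[ℝ] E) (iteratedFDeriv ℝ k h y)
    calc _ ≤ ‖(↑U⁻¹ : E →L[ℝ] E)‖ * ‖iteratedFDeriv ℝ k h y‖ / k.factorial := by gcongr
      _ = ‖(↑U⁻¹ : E →L[ℝ] E)‖ * (‖iteratedFDeriv ℝ k h y‖ / k.factorial) := by ring
      _ ≤ ((1 - u) ^ 2 / psi u) * (γ ^ (k - 1) / (1 - u) ^ (k + 1)) :=
          mul_le_mul hUinv (hDk k hk) (by positivity) (by positivity)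
      _ = γ ^ (k - 1) / ((1 - u) ^ (k - 1) * psi u) := by
          have : k + 1 = (k - 1) + 2 := by omega
          rw [this, pow_add]
          field_simp
      _ ≤ γ ^ (k - 1) / ((1 - u) ^ (k - 1) * psi u ^ (k - 1)) := by
          gcongr
          exact pow_le_of_le_one hψ.le hψ1 (by omega)
      _ = _ := by rw [div_pow, mul_pow]
  exact ⟨B, hBy, ⟨_, hbound⟩, csSup_le ⟨_, 2, le_rfl, rfl⟩ hbound⟩
end

section
/- Let f : D ⊆ E → F be an analytic map between real Banach spaces and let ζ ∈ D be a nondegenerate zero of f (f(ζ) = 0 and Df(ζ) invertible). Let δ and u₀ satisfy 0 ≤ 2δ ≤ u₀ ≤ 2 − √14/2, and assume the open ball B = B(ζ, u₀/γ(f,ζ)) is contained in D. Let (x_i) be a sequence in E with x₀ ∈ B such that, for every i, whenever x_i ∈ D and Df(x_i) is invertible, one has ‖x_{i+1} − N(f, x_i)‖·γ(f,ζ) ≤ δ. Define u_{i+1} = u_i²/ψ(u_i) + δ. Then for every i the point x_i lies in D, Df(x_i) is invertible, and ‖x_i − ζ‖·γ(f,ζ) ≤ u_i, with u_i/u₀ ≤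 max(2^{1−2^i}, 2δ/u₀). -/
open Filter Metric

/-- Real-variable facts about `ψ`. -/
lemma psi_lower (w : ℝ) (hw : 0 ≤ w) (hw0 : w ≤ 2 - Real.sqrt 14 / 2) : 4 * w ≤ psi w := by
  have h14 : Real.sqrt 14 ^ 2 = 14 := Real.sq_sqrt (by norm_num)
  have hp : 0 ≤ Real.sqrt 14 := Real.sqrt_nonneg _
  unfold psi
  nlinarith [mul_nonneg (sub_nonneg.2 hw0) (by linarith : 0 ≤ 2 + Real.sqrt 14 / 2 - w)]

lemma u0_lt (w : ℝ) (hw0 : w ≤ 2 - Real.sqrt 14 / 2) : w < 1 / 4 := by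
  have : (3.5 : ℝ) < Real.sqrt 14 := Real.lt_sqrt_of_sq_lt (by norm_num)
  linarith

lemma psi_anti {v w : ℝ} (hvw : v ≤ w) (hw : w ≤ 1 / 4) : psi w ≤ psi v := by
  unfold psi
  nlinarith [mul_nonneg (sub_nonneg.2 hvw) (by linarith : 0 ≤ 4 - 2 * (v + w))]

/-- Behaviour of the scalar recursion. -/
lemma scalar_rec (δ : ℝ) (u : ℕ → ℝ) (hδ : 0 ≤ δ) (h2δ : 2 * δ ≤ u 0)
    (hu0 : u 0 ≤ 2 - Real.sqrt 14 / 2) (hpos : 0 < u 0)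
    (hurec : ∀ i, u (i + 1) = u i ^ 2 / psi (u i) + δ) (i : ℕ) :
    0 ≤ u i ∧ u i ≤ u 0 ∧ (0 < i → u i < u 0) ∧
      u i / u 0 ≤ max ((2 : ℝ) ^ ((1 : ℤ) - 2 ^ i)) (2 * δ / u 0) := by
  have hlt := u0_lt _ hu0
  have hp0 := psi_lower _ hpos.le hu0
  induction i with
  | zero => simp [hpos.le, hpos.ne']
  | succ i ih =>
    obtain ⟨h0, h1, -, h3⟩ := ih
    have hpi : 4 * u 0 ≤ psi (u i) := hp0.trans (psi_anti h1 hlt.le)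
    have hq : u i ^ 2 / psi (u i) ≤ u i ^ 2 / (4 * u 0) := by gcongr
    have hq0 : 0 ≤ u i ^ 2 / psi (u i) := div_nonneg (sq_nonneg _) (by linarith)
    have hq1 : u i ^ 2 / (4 * u 0) ≤ u 0 / 4 := by
      rw [div_le_iff₀ (by positivity)]; nlinarith
    have hlt' : u (i + 1) < u 0 := by rw [hurec]; linarith
    refine ⟨by rw [hurec]; linarith, hlt'.le, fun _ => hlt', ?_⟩
    set w := u i / u 0 with hw
    set d := δ / u 0 with hd
    have hd2 : 2 * δ / u 0 = 2 * d := by rw [hd]; ring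
    have hd0 : 0 ≤ d := by positivity
    have hd1 : 2 * d ≤ 1 := by rw [← hd2, div_le_one hpos]; exact h2δ
    have hw0 : 0 ≤ w := by positivity
    have hstep : u (i + 1) / u 0 ≤ w ^ 2 / 4 + d := by
      have : w ^ 2 / 4 + d = (u i ^ 2 / (4 * u 0) + δ) / u 0 := by
        rw [hw, hd]; field_simp
      rw [this, hurec]; gcongr
    rw [hd2] at h3 ⊢
    have ha : (2 : ℝ) ^ ((1 : ℤ) - 2 ^ (i + 1)) = ((2 : ℝ) ^ ((1 : ℤ) - 2 ^ i)) ^ 2 / 2 := by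
      rw [← zpow_natCast, ← zpow_mul, div_eq_mul_inv, ← zpow_sub_one₀ (by norm_num : (2 : ℝ) ≠ 0)]
      congr 1; push_cast; ring
    rw [ha]
    set a := (2 : ℝ) ^ ((1 : ℤ) - 2 ^ i) with haa
    have ha0 : 0 < a := by positivity
    rcases le_max_iff.1 h3 with h | h
    · have : w ^ 2 ≤ a ^ 2 := by gcongr
      rcases le_total (a ^ 2 / 2) (2 * d) with h' | h'
      · rw [max_eq_right h']; linarith
      · rw [max_eq_left h']; linarith
    · refine le_trans ?_ (le_max_right _ _)
      have : w ^ 2 ≤ (2 * d) ^ 2 := by gcongr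
      nlinarith

section helpers
variable {E F : Type*} [NormedAddCommGroup E] [NormedSpace ℝ E] [CompleteSpace E]
    [NormedAddCommGroup F] [NormedSpace ℝ F]

/-- Norm bound for the derivative series. -/
lemma norm_derivSeries_le (p : FormalMultilinearSeries ℝ E F) (n : ℕ) :
    ‖p.derivSeries n‖ ≤ (n + 1) * ‖p (n + 1)‖ := by
  have h1 : ‖p.derivSeries n‖ ≤ ‖p.changeOriginSeries 1 n‖ := by
    refine ContinuousMultilinearMap.opNorm_le_bound (ContinuousMultilinearMap.opNorm_nonneg _) fun m => ?_
    have : ‖p.derivSeries n m‖ = ‖p.changeOriginSeries 1 n m‖ :=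
      (continuousMultilinearCurryFin1 ℝ E F).norm_map _
    rw [this]
    exact ContinuousMultilinearMap.le_opNorm _ _
  refine h1.trans ?_
  have h2 := p.nnnorm_changeOriginSeries_le_tsum 1 n
  rw [tsum_fintype, Finset.sum_const, Finset.card_univ, Fintype.card_finset_len, Fintype.card_fin,
    Nat.add_comm 1 n, Nat.choose_succ_self_right] at h2
  have h3 : ‖p.changeOriginSeries 1 n‖ ≤ ((n + 1 : ℕ) • ‖p (n + 1)‖₊ : NNReal) := by
    exact_mod_cast h2
  simpa using h3

/-- Derivatives of an analytic map grow geometrically. -/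
lemma analytic_bound (g : E → F) [CompleteSpace F] (ζ : E) (hg : AnalyticAt ℝ g ζ) :
    ∃ M : ℝ, ∀ k : ℕ, 2 ≤ k →
      (‖iteratedFDeriv ℝ k g ζ‖ / (Nat.factorial k : ℝ)) ^ ((1 : ℝ) / ((k : ℝ) - 1)) ≤ M := by
  obtain ⟨p, r, hp⟩ := hg
  obtain ⟨s, hs0, hsr⟩ := ENNReal.lt_iff_exists_nnreal_btwn.1 (hp.r_pos.trans_le hp.r_le)
  have hs0' : 0 < s := by exact_mod_cast hs0
  obtain ⟨C, hC, hb⟩ := p.norm_le_div_pow_of_pos_of_lt_radius hs0' hsr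
  set K := max C 1
  set a := max ((s : ℝ)⁻¹) 1
  have hK : 1 ≤ K := le_max_right _ _
  have ha : 1 ≤ a := le_max_right _ _
  refine ⟨K * a ^ 2, fun k hk => ?_⟩
  obtain ⟨m, rfl⟩ : ∃ m, k = m + 2 := ⟨k - 2, by omega⟩
  have h1 : ‖iteratedFDeriv ℝ (m + 2) g ζ‖ ≤ (Nat.factorial (m + 2) : ℝ) * ‖p (m + 2)‖ := by
    refine ContinuousMultilinearMap.opNorm_le_bound (by positivity) fun v => ?_
    rw [hp.iteratedFDeriv_eq_sum_of_completeSpace]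
    refine (norm_sum_le _ _).trans ?_
    have : ∀ σ ∈ (Finset.univ : Finset (Equiv.Perm (Fin (m + 2)))),
        ‖p (m + 2) fun i => v (σ i)‖ ≤ ‖p (m + 2)‖ * ∏ i, ‖v i‖ := fun σ _ => by
      refine (ContinuousMultilinearMap.le_opNorm _ _).trans (le_of_eq ?_)
      rw [Equiv.prod_comp σ (fun i => ‖v i‖)]
    refine (Finset.sum_le_sum this).trans (le_of_eq ?_)
    rw [Finset.sum_const, Finset.card_univ, Fintype.card_perm, Fintype.card_fin, nsmul_eq_mul]
    ring
  have hf : (0 : ℝ) < Nat.factorial (m + 2) := by positivity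
  have h2 : ‖iteratedFDeriv ℝ (m + 2) g ζ‖ / (Nat.factorial (m + 2) : ℝ) ≤ (K * a ^ 2) ^ (m + 1) := by
    rw [div_le_iff₀ hf, mul_comm]
    refine h1.trans ?_
    gcongr
    refine (hb _).trans ?_
    have e1 : C / (s : ℝ) ^ (m + 2) = C * ((s : ℝ)⁻¹) ^ (m + 2) := by
      rw [div_eq_mul_inv, inv_pow]
    rw [e1, mul_pow, ← pow_mul]
    have : C ≤ K ^ (m + 1) := (le_max_left C 1).trans (le_self_pow₀ hK (by omega))
    have : ((s : ℝ)⁻¹) ^ (m + 2) ≤ a ^ (2 * (m + 1)) :=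
      (pow_le_pow_left₀ (by positivity) (le_max_left _ _) _).trans
        (pow_le_pow_right₀ ha (by omega))
    gcongr
  have e : (1 : ℝ) / (((m + 2 : ℕ) : ℝ) - 1) = (((m + 1 : ℕ) : ℝ))⁻¹ := by
    rw [one_div]; congr 1; push_cast; ring
  rw [e]
  refine (Real.rpow_le_rpow (by positivity) h2 (by positivity)).trans (le_of_eq ?_)
  exact Real.pow_rpow_inv_natCast (by positivity) (by omega)

/-- The key one-step estimate for a power series tangent to the identity. -/
lemma newton_core (g : E → E) (p : FormalMultilinearSeries ℝ E E) (ζ x : E) (r : ENNReal)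
    (hp : HasFPowerSeriesOnBall g p ζ r) (γ : ℝ) (hγ : 0 ≤ γ)
    (hb : ∀ k, 2 ≤ k → ‖p k‖ ≤ γ ^ (k - 1)) (h0 : g ζ = 0)
    (h1 : fderiv ℝ g ζ = ContinuousLinearMap.id ℝ E) (hx : x ∈ Metric.eball ζ r)
    (hv : ‖x - ζ‖ * γ < 1 / 4) :
    ∃ B : E ≃L[ℝ] E, (B : E →L[ℝ] E) = fderiv ℝ g x ∧
      ‖x - B.symm (g x) - ζ‖ * γ ≤ (‖x - ζ‖ * γ) ^ 2 / psi (‖x - ζ‖ * γ) := by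
  set h := x - ζ with hh
  set v := ‖h‖ * γ with hvd
  have hv0 : 0 ≤ v := by positivity
  have hd := hp.fderiv
  have hs := hp.hasSum_sub hx
  have hsd := hd.hasSum_sub hx
  rw [← hh] at hs hsd
  have hdn : ∀ n, 1 ≤ n → ‖p.derivSeries n fun _ => h‖ ≤ (n + 1) * v ^ n := fun n hn => by
    refine (ContinuousMultilinearMap.le_opNorm _ _).trans ?_
    have := hb (n + 1) (by omega)
    have h2 := norm_derivSeries_le p n
    simp only [Nat.add_sub_cancel] at this
    rw [Finset.prod_const, Finset.card_univ, Fintype.card_fin, hvd, mul_pow]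
    calc ‖p.derivSeries n‖ * ‖h‖ ^ n ≤ ((n + 1) * γ ^ n) * ‖h‖ ^ n := by
          gcongr
          exact h2.trans (by gcongr)
      _ = _ := by ring
  have hd0 : (p.derivSeries 0 fun _ => h) = ContinuousLinearMap.id ℝ E := by
    rw [hd.coeff_zero, h1]
  have hvn : ‖v‖ < 1 := by rw [Real.norm_of_nonneg hv0]; linarith
  have hg1 : HasSum (fun n : ℕ => ((n : ℝ) + 1) * v ^ n) (1 / (1 - v) ^ 2) := by
    simpa using hasSum_choose_mul_geometric_of_norm_lt_one 1 hvn
  have hg2 : HasSum (fun n : ℕ => (n : ℝ) * v ^ n) (v / (1 - v) ^ 2) :=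
    hasSum_coe_mul_geometric_of_norm_lt_one hvn
  set T := fderiv ℝ g x with hT
  have hT1 : ‖T - ContinuousLinearMap.id ℝ E‖ ≤ 1 / (1 - v) ^ 2 - 1 := by
    refine HasSum.norm_le_of_bounded
      (hsd.sub (hasSum_ite_eq 0 (ContinuousLinearMap.id ℝ E)))
      (hg1.sub (hasSum_ite_eq 0 (1 : ℝ))) fun n => ?_
    rcases Nat.eq_zero_or_pos n with rfl | hn
    · simp [hd0]
    · simpa [hn.ne'] using hdn n hn
  have hsum : HasSum (fun n => p (n + 1) fun _ => h) (g x) := by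
    have := (hasSum_nat_add_iff' 1).2 hs
    simpa [hp.coeff_zero, h0] using this
  have hTh : HasSum (fun n => (p.derivSeries n fun _ => h) h) (T h) :=
    hsd.mapL (ContinuousLinearMap.apply ℝ E h)
  have hdiff : ‖T h - g x‖ ≤ ‖h‖ * (v / (1 - v) ^ 2) := by
    refine HasSum.norm_le_of_bounded (hTh.sub hsum) (hg2.mul_left ‖h‖) fun n => ?_
    rw [p.derivSeries_apply_diag, succ_nsmul, add_sub_cancel_right]
    rcases Nat.eq_zero_or_pos n with rfl | hn
    · simp
    · rw [← Nat.cast_smul_eq_nsmul ℝ, norm_smul, Real.norm_natCast]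
      have h3 : ‖p (n + 1) fun _ => h‖ ≤ γ ^ n * ‖h‖ ^ (n + 1) := by
        refine (ContinuousMultilinearMap.le_opNorm _ _).trans ?_
        rw [Finset.prod_const, Finset.card_univ, Fintype.card_fin]
        have := hb (n + 1) (by omega)
        simp only [Nat.add_sub_cancel] at this
        gcongr
      calc (n : ℝ) * ‖p (n + 1) fun _ => h‖ ≤ n * (γ ^ n * ‖h‖ ^ (n + 1)) := by gcongr
        _ = _ := by rw [hvd, mul_pow]; ring
  have h1v : 0 < (1 - v) ^ 2 := by have : 0 < 1 - v := by linarith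
                                   positivity
  have hψ : 0 < psi v := by unfold psi; nlinarith
  have heq : 1 - (1 / (1 - v) ^ 2 - 1) = psi v / (1 - v) ^ 2 := by
    rw [eq_div_iff h1v.ne', sub_sub_eq_add_sub, sub_mul, div_mul_cancel₀ _ h1v.ne']
    unfold psi; ring
  have hlt : 1 / (1 - v) ^ 2 - 1 < 1 := by
    have : 0 < psi v / (1 - v) ^ 2 := by positivity
    linarith
  have hn1 : ‖ContinuousLinearMap.id ℝ E - T‖ < 1 := by
    rw [norm_sub_rev]; exact hT1.trans_lt hlt
  let U : (E →L[ℝ] E)ˣ := Units.oneSub (ContinuousLinearMap.id ℝ E - T) hn1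
  let B : E ≃L[ℝ] E := ContinuousLinearEquiv.unitsEquiv ℝ E U
  have hB : (B : E →L[ℝ] E) = T := by
    have : (U : E →L[ℝ] E) = T := by
      change ContinuousLinearMap.id ℝ E - (ContinuousLinearMap.id ℝ E - T) = T
      abel
    rw [← this]; ext y; rfl
  refine ⟨B, hB, ?_⟩
  set y := x - B.symm (g x) - ζ with hy
  have hy' : y = h - B.symm (g x) := by rw [hy, hh]; abel
  have hTy : T y = T h - g x := by
    rw [hy', map_sub]
    congr 1
    rw [← hB]
    exact B.apply_symm_apply _
  have hlow : ‖y‖ * (psi v / (1 - v) ^ 2) ≤ ‖h‖ * (v / (1 - v) ^ 2) := by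
    have e1 : ‖y‖ ≤ ‖T y‖ + ‖(T - ContinuousLinearMap.id ℝ E) y‖ := by
      have : y = T y - (T - ContinuousLinearMap.id ℝ E) y := by simp
      calc ‖y‖ = ‖T y - (T - ContinuousLinearMap.id ℝ E) y‖ := by rw [← this]
        _ ≤ _ := norm_sub_le _ _
    have e2 : ‖(T - ContinuousLinearMap.id ℝ E) y‖ ≤ (1 / (1 - v) ^ 2 - 1) * ‖y‖ :=
      (ContinuousLinearMap.le_opNorm _ _).trans (by gcongr)
    rw [← heq]
    rw [hTy] at e1
    nlinarith
  rw [le_div_iff₀ hψ]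
  have h5 : ‖y‖ * psi v ≤ ‖h‖ * v := by
    have := mul_le_mul_of_nonneg_right hlow h1v.le
    have hne := h1v.ne'
    calc ‖y‖ * psi v = ‖y‖ * (psi v / (1 - v) ^ 2) * (1 - v) ^ 2 := by
          rw [mul_assoc, div_mul_cancel₀ _ hne]
      _ ≤ _ := this
      _ = _ := by rw [mul_assoc, div_mul_cancel₀ _ hne]
  calc ‖y‖ * γ * psi v = (‖y‖ * psi v) * γ := by ring
    _ ≤ (‖h‖ * v) * γ := by gcongr
    _ = v ^ 2 := by rw [hvd]; ring

/-- The Taylor series of an analytic map represents it on the whole ball where the Taylor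
series converges, as long as the map is analytic there. -/
lemma taylor_on_ball (g : E → E) (ζ : E) (r γ : ℝ) (hr : 0 < r) (hγ : 0 ≤ γ) (hrγ : r * γ ≤ 1)
    (hg : AnalyticOnNhd ℝ g (Metric.ball ζ r)) (c : FormalMultilinearSeries ℝ E E)
    (hc : ∀ k y, (c k fun _ => y) = ((Nat.factorial k : ℝ))⁻¹ • iteratedFDeriv ℝ k g ζ fun _ => y)
    (hb : ∀ k, 2 ≤ k → ‖c k‖ ≤ γ ^ (k - 1)) :
    HasFPowerSeriesOnBall g c ζ (ENNReal.ofReal r) := by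
  have hrad : ENNReal.ofReal r ≤ c.radius := by
    refine c.le_radius_of_bound (‖c 0‖ + ‖c 1‖ * r + r) fun n => ?_
    rw [Real.coe_toNNReal _ hr.le]
    match n with
    | 0 =>
      have : 0 ≤ ‖c 1‖ * r := by positivity
      rw [pow_zero, mul_one]; linarith
    | 1 => simp; linarith [norm_nonneg (c 0)]
    | m + 2 =>
      have h1 := hb (m + 2) (by omega)
      have e : m + 2 - 1 = m + 1 := by omega
      rw [e] at h1
      have : ‖c (m + 2)‖ * r ^ (m + 2) ≤ r := by
        calc ‖c (m + 2)‖ * r ^ (m + 2) ≤ γ ^ (m + 1) * r ^ (m + 2) := by gcongr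
          _ = (r * γ) ^ (m + 1) * r := by rw [mul_pow]; ring
          _ ≤ 1 * r := by
            gcongr
            exact pow_le_one₀ (by positivity) hrγ
          _ = r := one_mul r
      have : 0 ≤ ‖c 0‖ + ‖c 1‖ * r := by positivity
      linarith
  have hrpos : 0 < ENNReal.ofReal r := ENNReal.ofReal_pos.2 hr
  have hsum := (c.hasFPowerSeriesOnBall (hrpos.trans_le hrad)).mono hrpos hrad
  have hsum2 : HasFPowerSeriesOnBall (fun z => c.sum (z - ζ)) c ζ (ENNReal.ofReal r) := by
    simpa using hsum.comp_sub ζ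
  have heb : Metric.eball ζ (ENNReal.ofReal r) = Metric.ball ζ r := Metric.eball_ofReal
  have han : AnalyticOnNhd ℝ (fun z => c.sum (z - ζ)) (Metric.ball ζ r) := by
    rw [← heb]; exact hsum2.analyticOnNhd
  have hev : (fun z => c.sum (z - ζ)) =ᶠ[nhds ζ] g := by
    obtain ⟨p, s, hp⟩ := hg ζ (Metric.mem_ball_self hr)
    filter_upwards [Metric.eball_mem_nhds ζ hp.r_pos] with z hz
    have h1 := hp.hasSum_sub hz
    have h2 : (fun n => p n fun _ => z - ζ) = fun n => c n fun _ => z - ζ := by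
      funext n
      rw [hc, ← hp.factorial_smul (z - ζ) n, ← Nat.cast_smul_eq_nsmul ℝ, smul_smul,
        inv_mul_cancel₀ (by positivity), one_smul]
    rw [h2] at h1
    exact h1.tsum_eq
  have heq := han.eqOn_of_preconnected_of_eventuallyEq hg (convex_ball ζ r).isPreconnected
    (Metric.mem_ball_self hr) hev
  refine hsum2.congr ?_
  rw [heb]; exact heq

lemma gammaTerm_eq (f : E → F) (A : E ≃L[ℝ] F) (ζ : E) (k : ℕ) :
    gammaTerm f (A.symm : F →L[ℝ] E) ζ k =
      (‖iteratedFDeriv ℝ k (A.symm ∘ f) ζ‖ / (Nat.factorial k : ℝ)) ^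
        ((1 : ℝ) / ((k : ℝ) - 1)) := by
  unfold gammaTerm
  rw [ContinuousLinearEquiv.iteratedFDeriv_comp_left]

lemma smaleGamma_bound (f : E → F) (A : E ≃L[ℝ] F) (ζ : E)
    (hg : AnalyticAt ℝ (A.symm ∘ f) ζ) (k : ℕ) (hk : 2 ≤ k) :
    ‖iteratedFDeriv ℝ k (A.symm ∘ f) ζ‖ / (Nat.factorial k : ℝ) ≤
      smaleGamma f (A.symm : F →L[ℝ] E) ζ ^ (k - 1) := by
  obtain ⟨M, hM⟩ := analytic_bound _ ζ hg
  have hbdd : BddAbove (gammaSet f (A.symm : F →L[ℝ] E) ζ) := by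
    refine ⟨M, ?_⟩
    rintro _ ⟨k, hk, rfl⟩
    rw [gammaTerm_eq]; exact hM k hk
  have h := le_csSup hbdd ⟨k, hk, rfl⟩
  change _ ≤ smaleGamma f (A.symm : F →L[ℝ] E) ζ at h
  rw [gammaTerm_eq] at h
  obtain ⟨m, rfl⟩ : ∃ m, k = m + 2 := ⟨k - 2, by omega⟩
  have e : (1 : ℝ) / (((m + 2 : ℕ) : ℝ) - 1) = (((m + 1 : ℕ) : ℝ))⁻¹ := by
    rw [one_div]; congr 1; push_cast; ring
  rw [e] at h
  have e2 : m + 2 - 1 = m + 1 := by omega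
  rw [e2]
  have := pow_le_pow_left₀ (by positivity) h (m + 1)
  rwa [Real.rpow_inv_natCast_pow (by positivity) (by omega)] at this

lemma smaleGamma_nonneg (f : E → F) (A : E ≃L[ℝ] F) (ζ : E) :
    0 ≤ smaleGamma f (A.symm : F →L[ℝ] E) ζ := by
  refine Real.sSup_nonneg ?_
  rintro _ ⟨k, hk, rfl⟩
  unfold gammaTerm
  positivity

end helpers

/-- robust gamma theorem: let `ζ` be a nondegenerate zero of the analytic map
`f`, let `0 ≤ 2δ ≤ u₀ ≤ 2 - √14/2`, and suppose the ball `B(ζ, u₀/γ(f,ζ))` lies in `D`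
(multiplicative form).  If `(x_i)` starts in that ball and each `x_{i+1}` is within
`δ/γ(f,ζ)` of the Newton iterate of `x_i`, and `u_{i+1} = u_i²/ψ(u_i) + δ`, then every `x_i`
lies in `D` with `Df(x_i)` invertible, `‖x_i - ζ‖·γ(f,ζ) ≤ u_i`, and
`u_i/u₀ ≤ max (2^(1-2^i)) (2δ/u₀)`. -/
theorem stmt8 {E F : Type*} [NormedAddCommGroup E] [NormedSpace ℝ E] [CompleteSpace E]
    [NormedAddCommGroup F] [NormedSpace ℝ F] [CompleteSpace F]
    (D : Set E) (hD : IsOpen D) (f : E → F) (hf : AnalyticOnNhd ℝ f D)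
    (ζ : E) (hζ : ζ ∈ D) (hfζ : f ζ = 0)
    (A : E ≃L[ℝ] F) (hA : (A : E →L[ℝ] F) = fderiv ℝ f ζ)
    (δ : ℝ) (u : ℕ → ℝ)
    (hδ : 0 ≤ δ) (h2δ : 2 * δ ≤ u 0) (hu0 : u 0 ≤ 2 - Real.sqrt 14 / 2)
    (hurec : ∀ i, u (i + 1) = u i ^ 2 / psi (u i) + δ)
    (hball : ∀ x : E, ‖x - ζ‖ * smaleGamma f (A.symm : F →L[ℝ] E) ζ < u 0 → x ∈ D)
    (x : ℕ → E)
    (hx0 : ‖x 0 - ζ‖ * smaleGamma f (A.symm : F →L[ℝ] E) ζ < u 0)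
    (hstep : ∀ (i : ℕ) (B : E ≃L[ℝ] F), x i ∈ D → (B : E →L[ℝ] F) = fderiv ℝ f (x i) →
      ‖x (i + 1) - (x i - B.symm (f (x i)))‖ * smaleGamma f (A.symm : F →L[ℝ] E) ζ ≤ δ) :
    ∀ i : ℕ, x i ∈ D ∧ (∃ B : E ≃L[ℝ] F, (B : E →L[ℝ] F) = fderiv ℝ f (x i)) ∧
      ‖x i - ζ‖ * smaleGamma f (A.symm : F →L[ℝ] E) ζ ≤ u i ∧
      u i / u 0 ≤ max ((2 : ℝ) ^ ((1 : ℤ) - 2 ^ i)) (2 * δ / u 0) := by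
  set γ := smaleGamma f (A.symm : F →L[ℝ] E) ζ with hγdef
  have hγ : 0 ≤ γ := smaleGamma_nonneg f A ζ
  have hpos : 0 < u 0 := lt_of_le_of_lt (by positivity) hx0
  have hS := scalar_rec δ u hδ h2δ hu0 hpos hurec
  have hlt := u0_lt _ hu0
  have hgD : AnalyticOnNhd ℝ (A.symm ∘ f) D := fun z hz =>
    (A.symm : F →L[ℝ] E).analyticAt _ |>.comp (hf z hz)
  have hγb := smaleGamma_bound f A ζ (hgD ζ hζ)
  rw [← hγdef] at hγb
  set g : E → E := A.symm ∘ f with hgdef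
  have hg0 : g ζ = 0 := by simp [hgdef, hfζ]
  have hg1 : fderiv ℝ g ζ = ContinuousLinearMap.id ℝ E := by
    rw [hgdef, ContinuousLinearEquiv.comp_fderiv, ← hA]
    ext y; simp
  let c : FormalMultilinearSeries ℝ E E := fun k =>
    ((Nat.factorial k : ℝ))⁻¹ • iteratedFDeriv ℝ k g ζ
  have hcb : ∀ k, 2 ≤ k → ‖c k‖ ≤ γ ^ (k - 1) := fun k hk => by
    have := hγb k hk
    rw [div_eq_inv_mul] at this
    simpa [c, norm_smul] using this
  -- one Newton step
  have key : ∀ z : E, ‖z - ζ‖ * γ < u 0 → ∃ B : E ≃L[ℝ] F, (B : E →L[ℝ] F) = fderiv ℝ f z ∧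
      ‖z - B.symm (f z) - ζ‖ * γ ≤ (‖z - ζ‖ * γ) ^ 2 / psi (‖z - ζ‖ * γ) := by
    intro z hz
    obtain ⟨r, hr0, hzr, hrγ⟩ : ∃ r : ℝ, 0 < r ∧ ‖z - ζ‖ < r ∧ r * γ ≤ u 0 := by
      rcases hγ.eq_or_lt with h | h
      · exact ⟨‖z - ζ‖ + 1, by positivity, by linarith, by rw [← h]; linarith⟩
      · exact ⟨u 0 / γ, by positivity, by rwa [lt_div_iff₀ h], by rw [div_mul_cancel₀ _ h.ne']⟩
    have hsub : Metric.ball ζ r ⊆ D := fun y hy => by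
      rw [mem_ball, dist_eq_norm] at hy
      apply hball
      rcases hγ.eq_or_lt with h | h
      · rw [← h]; simpa using hpos
      · exact (mul_lt_mul_of_pos_right hy h).trans_le hrγ
    have hps := taylor_on_ball g ζ r γ hr0 hγ (by linarith) (hgD.mono hsub) c
      (fun k y => rfl) hcb
    have hzm : z ∈ Metric.eball ζ (ENNReal.ofReal r) := by
      rw [Metric.eball_ofReal, mem_ball, dist_eq_norm]; exact hzr
    obtain ⟨B, hB, hBn⟩ := newton_core g c ζ z _ hps γ hγ hcb hg0 hg1 hzm (by linarith)
    refine ⟨B.trans A, ?_, ?_⟩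
    · rw [hgdef, ContinuousLinearEquiv.comp_fderiv] at hB
      ext y
      have := congrArg (fun T : E →L[ℝ] E => A (T y)) hB
      simpa using this
    · exact hBn
  have main : ∀ i, ‖x i - ζ‖ * γ < u 0 ∧ ‖x i - ζ‖ * γ ≤ u i := by
    intro i
    induction i with
    | zero => exact ⟨hx0, hx0.le⟩
    | succ i ih =>
      obtain ⟨B, hB, hBn⟩ := key (x i) ih.1
      have hs := hstep i B (hball _ ih.1) hB
      have hv0 : 0 ≤ ‖x i - ζ‖ * γ := by positivity
      have hui : u i ≤ u 0 := (hS i).2.1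
      have hψ1 : psi (u i) ≤ psi (‖x i - ζ‖ * γ) := psi_anti ih.2 (by linarith)
      have hψ0 : 0 < psi (u i) := by unfold psi; nlinarith [sq_nonneg (u i)]
      have hmono : (‖x i - ζ‖ * γ) ^ 2 / psi (‖x i - ζ‖ * γ) ≤ u i ^ 2 / psi (u i) := by
        have := ih.2
        gcongr
      have htri : ‖x (i + 1) - ζ‖ ≤ ‖x (i + 1) - (x i - B.symm (f (x i)))‖ +
          ‖x i - B.symm (f (x i)) - ζ‖ := norm_sub_le_norm_sub_add_norm_sub _ _ _
      have hle : ‖x (i + 1) - ζ‖ * γ ≤ u (i + 1) := by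
        rw [hurec]
        have := mul_le_mul_of_nonneg_right htri hγ
        rw [add_mul] at this
        linarith
      exact ⟨hle.trans_lt ((hS (i + 1)).2.2.1 (Nat.succ_pos i)), hle⟩
  intro i
  obtain ⟨h1, h2⟩ := main i
  obtain ⟨B, hB, -⟩ := key (x i) h1
  exact ⟨hball _ h1, ⟨B, hB⟩, h2, (hS i).2.2.2⟩
end

section
/- Let β, γ > 0 with α = βγ < 3 − 2√2, and let h_{βγ}, ζ₁, ζ₂, η, q be as defined. Define t₀ = 0 and t_{i+1} = N(h_{βγ}, t_i) = t_i − h_{βγ}(t_i)/h_{βγ}′(t_i). Then the sequence (t_i) is well-defined for all i (each t_i satisfies γ·t_i ≠ 1 and h_{βγ}′(t_i) ≠ 0), and for all i, t_i = ζ₁·(1 − q^{2^i − 1})/(1 − η·q^{2^i − 1}). -/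
/-- The universal function `h_{βγ}(t) = β - t + γt²/(1 - γt)`. -/
noncomputable def hbg (β γ t : ℝ) : ℝ := β - t + γ * t ^ 2 / (1 - γ * t)

/-- Algebraic core of one Newton step, in terms of the two zeros `a`, `b`. -/
lemma newton_core_s9 (a b q x u v D N : ℝ) (hab : a ≠ b) (hrel : 2 * a + 2 * b = 1 + 2 * a * b)
    (hq : b * (1 - 2 * a * b + 2 * b) * q = a * (1 - 2 * a * b + 2 * a))
    (hx : b - a * x ≠ 0) (hy : b - a * (q * x ^ 2) ≠ 0)
    (hu : u * (b - a * x) = a * b * (1 - x))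
    (hv : v * (b - a * (q * x ^ 2)) = a * b * (1 - q * x ^ 2))
    (hD : D = -1 + 4 * u - 2 * u ^ 2) (hD0 : D ≠ 0)
    (hN : N * D = 2 * (2 * a * b) * u + (1 - 2 * a * b) * u ^ 2 - 2 * a * b) : v = N := by
  have h1 : (N - a) * D = (1 - 2 * a * b + 2 * a) * (u - a) ^ 2 := by
    subst hD
    linear_combination hN + (2 * a * u - a - a ^ 2) * hrel
  have h2 : (N - b) * D = (1 - 2 * a * b + 2 * b) * (u - b) ^ 2 := by
    subst hD
    linear_combination hN + (2 * b * u - b - b ^ 2) * hrel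
  have e1 : (u - a) * (b - a * x) = -a * (b - a) * x := by linear_combination hu
  have e2 : (u - b) * (b - a * x) = -b * (b - a) := by linear_combination hu
  have e3 : (v - a) * (b - a * (q * x ^ 2)) = -a * (b - a) * (q * x ^ 2) := by
    linear_combination hv
  have e4 : (v - b) * (b - a * (q * x ^ 2)) = -b * (b - a) := by linear_combination hv
  have f1 : (N - a) * D * (b - a * x) ^ 2
      = (1 - 2 * a * b + 2 * a) * (-a * (b - a) * x) ^ 2 := by
    rw [h1, ← e1]; ring
  have f2 : (N - b) * D * (b - a * x) ^ 2
      = (1 - 2 * a * b + 2 * b) * (-b * (b - a)) ^ 2 := by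
    rw [h2, ← e2]; ring
  have key : ((N - a) * (v - b) - (N - b) * (v - a))
      * (D * (b - a * x) ^ 2 * (b - a * (q * x ^ 2))) = 0 := by
    have : ((N - a) * (v - b) - (N - b) * (v - a)) * (D * (b - a * x) ^ 2 * (b - a * (q * x ^ 2)))
      = ((N - a) * D * (b - a * x) ^ 2) * ((v - b) * (b - a * (q * x ^ 2)))
       - ((N - b) * D * (b - a * x) ^ 2) * ((v - a) * (b - a * (q * x ^ 2))) := by ring
    rw [this, f1, f2, e3, e4]
    linear_combination (b - a) ^ 3 * a * b * x ^ 2 * hq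
  have hne : D * (b - a * x) ^ 2 * (b - a * (q * x ^ 2)) ≠ 0 := by positivity
  have h3 := (mul_eq_zero.mp key).resolve_right hne
  have h4 : (v - N) * (a - b) = 0 := by linear_combination -h3
  have h5 := (mul_eq_zero.mp h4).resolve_right (sub_ne_zero.mpr hab)
  linarith

lemma hbg_hasDerivAt (β γ t : ℝ) (h : 1 - γ * t ≠ 0) :
    HasDerivAt (hbg β γ) (-2 + 1 / (1 - γ * t) ^ 2) t := by
  have h1 : HasDerivAt (fun t : ℝ => 1 - γ * t) (-γ) t := by
    simpa using ((hasDerivAt_id t).const_mul γ).const_sub 1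
  have h2 : HasDerivAt (fun t : ℝ => γ * t ^ 2) (γ * (2 * t)) t := by
    simpa using (hasDerivAt_pow 2 t).const_mul γ
  have h3 : HasDerivAt (fun t : ℝ => β - t) (-1) t := by
    simpa using (hasDerivAt_id t).const_sub β
  have h4 := h3.add (h2.div h1 h)
  refine h4.congr_deriv ?_
  field_simp
  ring

/-- closed form for Newton iteration on the universal function `h_{βγ}`.
With `α = βγ < 3 - 2√2`, `Δ = (1+α)² - 8α`, `ζ₁ = (1+α-√Δ)/(4γ)`,
`η = (1+α-√Δ)/(1+α+√Δ)`, `q = (1-α-√Δ)/(1-α+√Δ)`, the Newton sequence starting at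
`t₀ = 0` is well-defined and `t_i = ζ₁·(1 - q^(2^i-1))/(1 - η·q^(2^i-1))`. -/
theorem stmt9 (β γ α Δ ζ₁ ζ₂ η q : ℝ)
    (hβ : 0 < β) (hγ : 0 < γ)
    (hα : α = β * γ) (hlt : α < 3 - 2 * Real.sqrt 2)
    (hΔ : Δ = (1 + α) ^ 2 - 8 * α)
    (hζ₁ : ζ₁ = (1 + α - Real.sqrt Δ) / (4 * γ))
    (hζ₂ : ζ₂ = (1 + α + Real.sqrt Δ) / (4 * γ))
    (hη : η = (1 + α - Real.sqrt Δ) / (1 + α + Real.sqrt Δ))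
    (hq : q = (1 - α - Real.sqrt Δ) / (1 - α + Real.sqrt Δ)) :
    ∃ t : ℕ → ℝ, t 0 = 0 ∧
      (∀ i, γ * t i ≠ 1 ∧ deriv (hbg β γ) (t i) ≠ 0 ∧
        t (i + 1) = t i - hbg β γ (t i) / deriv (hbg β γ) (t i)) ∧
      ∀ i, t i = ζ₁ * (1 - q ^ (2 ^ i - 1)) / (1 - η * q ^ (2 ^ i - 1)) := by
  have hαpos : 0 < α := by rw [hα]; positivity
  have hr2 : Real.sqrt 2 ^ 2 = 2 := Real.sq_sqrt (by norm_num)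
  have hr0 : 0 < Real.sqrt 2 := by positivity
  have hr1 : 1 < Real.sqrt 2 := by nlinarith
  have hα1 : α < 1 := by linarith
  have hΔpos : 0 < Δ := by
    rw [hΔ]
    nlinarith
  obtain ⟨s, hs⟩ : ∃ s, s = Real.sqrt Δ := ⟨_, rfl⟩
  have hs0 : 0 < s := by rw [hs]; exact Real.sqrt_pos.mpr hΔpos
  have hs2 : s ^ 2 = (1 + α) ^ 2 - 8 * α := by rw [hs, Real.sq_sqrt hΔpos.le, hΔ]
  rw [← hs] at hζ₁ hη hq
  have hs1 : s < 1 - α := by nlinarith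
  obtain ⟨a, ha⟩ : ∃ a, a = (1 + α - s) / 4 := ⟨_, rfl⟩
  obtain ⟨b, hb⟩ : ∃ b, b = (1 + α + s) / 4 := ⟨_, rfl⟩
  have ha0 : 0 < a := by linarith
  have hb0 : 0 < b := by linarith
  have hab : a < b := by linarith
  have habα : 2 * a * b = α := by rw [ha, hb]; linear_combination (-1/8) * hs2
  have hrel : 2 * a + 2 * b = 1 + 2 * a * b := by rw [habα, ha, hb]; ring
  have hζ : ζ₁ = a / γ := by rw [hζ₁, ha]; field_simp
  have hηab : η = a / b := by
    rw [hη, ha, hb]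
    have : 1 + α + s ≠ 0 := by positivity
    field_simp
  have hq0 : 0 < q := by rw [hq]; apply div_pos <;> linarith
  have hq1 : q < 1 := by rw [hq, div_lt_one (by linarith)]; linarith
  have hqrel : b * (1 - 2 * a * b + 2 * b) * q = a * (1 - 2 * a * b + 2 * a) := by
    have hd : 1 - α + s ≠ 0 := by linarith
    have hq' : q * (1 - α + s) = 1 - α - s := by rw [hq]; field_simp
    rw [habα, ha, hb]
    linear_combination (1/2) * hq' + (q - 1) / 8 * hs2
  have ha2 : a < 1 - Real.sqrt 2 / 2 := by rw [ha]; linarith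
  -- bounds on the powers
  have hx0 : ∀ n : ℕ, 0 < q ^ n := fun n => pow_pos hq0 n
  have hx1 : ∀ n : ℕ, q ^ n ≤ 1 := fun n => pow_le_one₀ hq0.le hq1.le
  have hden : ∀ n : ℕ, 0 < b - a * q ^ n := fun n => by nlinarith [hx0 n, hx1 n]
  have hform : ∀ n : ℕ, γ * (ζ₁ * (1 - q ^ n) / (1 - η * q ^ n)) * (b - a * q ^ n)
      = a * b * (1 - q ^ n) := fun n => by
    have h1 : 1 - η * q ^ n = (b - a * q ^ n) / b := by rw [hηab]; field_simp
    have h2 := (hden n).ne'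
    rw [h1, hζ]
    field_simp
  refine ⟨fun i => ζ₁ * (1 - q ^ (2 ^ i - 1)) / (1 - η * q ^ (2 ^ i - 1)), by simp, ?_,
    fun i => rfl⟩
  intro i
  have hpow : q ^ (2 ^ (i + 1) - 1) = q * (q ^ (2 ^ i - 1)) ^ 2 := by
    rw [← pow_mul, ← pow_succ']
    congr 1
    have : 0 < 2 ^ i := by positivity
    rw [pow_succ]
    omega
  have hu := hform (2 ^ i - 1)
  have hv := hform (2 ^ (i + 1) - 1)
  have hy := hden (2 ^ (i + 1) - 1)
  have hx := hden (2 ^ i - 1)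
  have hX0 := hx0 (2 ^ i - 1)
  beta_reduce
  generalize ζ₁ * (1 - q ^ (2 ^ (i + 1) - 1)) / (1 - η * q ^ (2 ^ (i + 1) - 1)) = T' at hv ⊢
  generalize ζ₁ * (1 - q ^ (2 ^ i - 1)) / (1 - η * q ^ (2 ^ i - 1)) = T at hu ⊢
  rw [hpow] at hv hy
  generalize q ^ (2 ^ i - 1) = x at *
  have hua : γ * T < a := by
    have : (a - γ * T) * (b - a * x) = a * (b - a) * x := by linear_combination -hu
    have h2 : 0 < (a - γ * T) * (b - a * x) := by
      rw [this]; exact mul_pos (mul_pos ha0 (by linarith)) hX0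
    have := (pos_iff_pos_of_mul_pos h2).mpr hx
    linarith
  have hw : Real.sqrt 2 / 2 < 1 - γ * T := by linarith
  have hw0 : 0 < 1 - γ * T := by linarith
  have hw2 : 1 < 2 * (1 - γ * T) ^ 2 := by
    have := pow_lt_pow_left₀ hw (by positivity) two_ne_zero
    rw [div_pow, hr2] at this
    linarith
  have hD0 : -1 + 4 * (γ * T) - 2 * (γ * T) ^ 2 ≠ 0 := by
    intro h; linarith [show -1 + 4 * (γ * T) - 2 * (γ * T) ^ 2 = 1 - 2 * (1 - γ * T) ^ 2 by ring]
  have hD1 : (1 - 2 * (1 - γ * T) ^ 2) ≠ 0 := by linarith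
  have hderiv : deriv (hbg β γ) T = (1 - 2 * (1 - γ * T) ^ 2) / (1 - γ * T) ^ 2 := by
    rw [(hbg_hasDerivAt β γ T hw0.ne').deriv]
    have := hw0.ne'
    field_simp
    ring
  refine ⟨by linarith, ?_, ?_⟩
  · rw [hderiv]
    exact div_ne_zero hD1 (by positivity)
  · have key := newton_core_s9 a b q x (γ * T) (γ * T') _
      (γ * (T - hbg β γ T / deriv (hbg β γ) T)) hab.ne hrel hqrel hx.ne' hy.ne' hu hv rfl hD0 ?_
    · exact mul_left_cancel₀ hγ.ne' key
    · have hh : hbg β γ T / deriv (hbg β γ) T * (1 - 2 * (1 - γ * T) ^ 2)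
          = (β - (1 + α) * T + 2 * γ * T ^ 2) * (1 - γ * T) := by
        rw [hderiv, hbg, hα]
        have := hw0.ne'
        generalize hE : 1 - 2 * (1 - γ * T) ^ 2 = E at *
        generalize hW : 1 - γ * T = W at *
        have hT : γ * T = 1 - W := by linarith
        field_simp
        rw [← hW]
        ring
      rw [habα, hα]
      rw [hα] at hh
      linear_combination (-γ) * hh
end

section
/- Let β, γ > 0 with α = βγ < 3 − 2√2, and let h_{βγ} be as defined. Then t₀ = 0 is an approximate zero of the second kind for h_{βγ} if and only if α ≤ (13 − 3√17)/4. That is: the Newton sequence t₀ = 0, t_{i+1} = N(h_{βγ}, t_i) is well-defined, converges to a zero of h_{βγ}, and satisfies |t_{i+1} − t_i| ≤ 2^{1−2^i}·|t₁ − t₀| for all i ≥ 0, precisely when α ≤ (13 − 3√17)/4. -/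
open Filter Topology

/-- Closed form of the (scaled) Newton iterates. -/
noncomputable def XX (a b Q : ℝ) : ℝ := a * b * (1 - Q) / (b - a * Q)

lemma hbg_eq (a b β γ t : ℝ) (hγ : 0 < γ) (hab : 1 - a - b + a * b = 1 / 2)
    (hα : β * γ = 2 * a * b) (ht : γ * t ≠ 1) :
    hbg β γ t = 2 * (γ * t - a) * (γ * t - b) / (γ * (1 - γ * t)) := by
  have h1 : 1 - γ * t ≠ 0 := fun h => ht (by linarith)
  have h2 : a + b = 1 / 2 + a * b := by linarith
  unfold hbg
  rw [eq_div_iff (by positivity)]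
  have : (β - t + γ * t ^ 2 / (1 - γ * t)) * (γ * (1 - γ * t))
      = (β * γ - γ * t) * (1 - γ * t) + (γ * t) ^ 2 := by
    have h3 : γ * t ^ 2 / (1 - γ * t) * (1 - γ * t) = γ * t ^ 2 := div_mul_cancel₀ _ h1
    linear_combination γ * h3
  rw [this, hα]
  linear_combination (2 * γ * t) * h2

lemma deriv_hbg (β γ t : ℝ) (ht : γ * t ≠ 1) :
    deriv (hbg β γ) t = -2 + 1 / (1 - γ * t) ^ 2 := by
  have h1 : 1 - γ * t ≠ 0 := fun h => ht (by linarith)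
  have hid : HasDerivAt (fun x : ℝ => x) 1 t := hasDerivAt_id t
  have hd : HasDerivAt (hbg β γ)
      (-1 + ((γ * (2 * t)) * (1 - γ * t) - γ * t ^ 2 * (-(γ * 1))) / (1 - γ * t) ^ 2) t := by
    have e1 := (hid.const_sub β)
    have e2 : HasDerivAt (fun x : ℝ => γ * x ^ 2) (γ * (2 * t)) t := by
      have := (hid.pow 2).const_mul γ
      simpa using this
    have e3 : HasDerivAt (fun x : ℝ => 1 - γ * x) (-(γ * 1)) t := (hid.const_mul γ).const_sub 1
    exact e1.add (e2.div e3 h1)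
  rw [hd.deriv]
  field_simp
  ring

lemma deriv_ne (a b β γ t : ℝ) (hb : a < b) (hb1 : b < 1)
    (hab : 1 - a - b + a * b = 1 / 2) (ht : γ * t ≤ a) :
    γ * t ≠ 1 ∧ deriv (hbg β γ) t ≠ 0 := by
  have h1 : γ * t ≠ 1 := by intro h; linarith
  refine ⟨h1, ?_⟩
  rw [deriv_hbg β γ t h1]
  have h2 : 1 / 2 < (1 - γ * t) ^ 2 := by nlinarith
  have h3 : 1 / (1 - γ * t) ^ 2 < 2 := by
    rw [div_lt_iff₀ (by linarith)]; linarith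
  intro h; linarith

lemma XX_le (a b Q : ℝ) (ha : 0 < a) (hb : a < b) (hQ0 : 0 ≤ Q) (hQ1 : Q ≤ 1) :
    XX a b Q ≤ a := by
  unfold XX
  have : 0 < b - a * Q := by nlinarith
  rw [div_le_iff₀ this]
  nlinarith [mul_nonneg (mul_nonneg ha.le hQ0) (sub_pos.2 hb).le]

lemma newton_step (a b β γ t q Q : ℝ) (hγ : 0 < γ) (ha : 0 < a) (hb : a < b) (hb1 : b < 1)
    (hab : 1 - a - b + a * b = 1 / 2) (hα : β * γ = 2 * a * b)
    (hq : q = a * (1 - b) / (b * (1 - a))) (hq1 : q < 1)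
    (hQ0 : 0 ≤ Q) (hQ1 : Q ≤ 1) (ht : γ * t = XX a b Q) :
    γ * (t - hbg β γ t / deriv (hbg β γ) t) = XX a b (q * Q ^ 2) := by
  have hxa := XX_le a b Q ha hb hQ0 hQ1
  obtain ⟨h1, hd⟩ := deriv_ne a b β γ t hb hb1 hab (ht ▸ hxa)
  have hb0 : 0 < b := ha.trans hb
  have hq0 : 0 < q := by rw [hq]; have := sub_pos.2 hb1; have := sub_pos.2 (hb.trans hb1); positivity
  have hD : 0 < b - a * Q := by nlinarith
  have hQ2 : q * Q ^ 2 ≤ 1 := by nlinarith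
  have hD2 : 0 < b - a * (q * Q ^ 2) := by nlinarith
  have hqe : q * (b * (1 - a)) = a * (1 - b) := by
    rw [hq, div_mul_cancel₀]; have := sub_pos.2 (hb.trans hb1); positivity
  rw [deriv_hbg β γ t h1] at hd ⊢
  rw [hbg_eq a b β γ t hγ hab hα h1]
  have h1x : 0 < 1 - γ * t := by rw [ht]; linarith
  set x := γ * t with hx
  have hN : -2 + 1 / (1 - x) ^ 2 = (1 - 2 * (1 - x) ^ 2) / (1 - x) ^ 2 := by field_simp; ring
  rw [hN] at hd ⊢
  have hE : 1 - 2 * (1 - x) ^ 2 ≠ 0 := by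
    intro h; apply hd; rw [h]; simp
  have hl : γ * (t - 2 * (x - a) * (x - b) / (γ * (1 - x)) / ((1 - 2 * (1 - x) ^ 2) / (1 - x) ^ 2))
      = x - 2 * (x - a) * (x - b) * (1 - x) / (1 - 2 * (1 - x) ^ 2) := by
    rw [mul_sub, ← hx]
    field_simp
  rw [hl]
  have hxQ : x * (b - a * Q) = a * b * (1 - Q) := by
    rw [ht]; unfold XX; field_simp
  unfold XX
  rw [eq_div_iff hD2.ne', sub_mul, div_mul_eq_mul_div, sub_eq_iff_eq_add, ← sub_eq_iff_eq_add',
    eq_div_iff hE]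
  have k0 : a * Q * (x - b) = b * (x - a) := by linear_combination -hxQ
  have k1 : (1 - 2 * (1 - x) ^ 2) - 2 * (x - b) * (1 - x) = 2 * (x - a) * (1 - b) := by
    linear_combination (-2) * hab
  have k2 : (1 - 2 * (1 - x) ^ 2) - 2 * (x - a) * (1 - x) = 2 * (x - b) * (1 - a) := by
    linear_combination (-2) * hab
  apply mul_left_cancel₀ ha.ne'
  have k3 : a * (b * (x - a) * (2 * (x - a) * (1 - b)))
      = a * (a * q * Q ^ 2 * (x - b) * (2 * (x - b) * (1 - a))) := by
    have : a * (a * q * Q ^ 2 * (x - b) * (2 * (x - b) * (1 - a)))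
      = 2 * q * (1 - a) * (a * Q * (x - b)) ^ 2 := by ring
    rw [this, k0]
    linear_combination (-2 * b * (x - a) ^ 2) * hqe
  rw [← k1, ← k2] at k3
  linear_combination k3

lemma XX_diff (a b q Q : ℝ) (h1 : b - a * Q ≠ 0) (h2 : b - a * (q * Q ^ 2) ≠ 0) :
    XX a b (q * Q ^ 2) - XX a b Q =
      a * b * (b - a) * (Q * (1 - q * Q)) / ((b - a * Q) * (b - a * (q * Q ^ 2))) := by
  unfold XX
  rw [div_sub_div _ _ h2 h1, div_eq_div_iff (by positivity) (by positivity)]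
  ring

lemma ratio_bound (a b q Q R : ℝ) (ha : 0 < a) (hb : a < b) (hq0 : 0 < q) (hq1 : q < 1)
    (hqe : q * b ≤ a) (hQ0 : 0 ≤ Q) (hQ1 : Q ≤ 1) (hR : Q ≤ R) :
    XX a b (q * Q ^ 2) - XX a b Q ≤ R * (XX a b q - XX a b 1) := by
  have hb0 : 0 < b := ha.trans hb
  have hD : 0 < b - a * Q := by nlinarith
  have hQ2 : q * Q ^ 2 ≤ q := mul_le_of_le_one_right hq0.le (pow_le_one₀ hQ0 hQ1)
  have hD2 : 0 < b - a * (q * Q ^ 2) := by nlinarith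
  have hD3 : 0 < b - a * q := by nlinarith
  have hba : 0 < b - a := by linarith
  have e := XX_diff a b q 1 (by rw [mul_one]; exact hba.ne') (by simpa using hD3.ne')
  simp only [one_pow, mul_one, one_mul] at e
  rw [e, XX_diff a b q Q hD.ne' hD2.ne']
  have hc : 0 < a * b * (b - a) := by positivity
  have h1q : 0 < 1 - q := by linarith
  have key : (1 - q * Q) / ((b - a * Q) * (b - a * (q * Q ^ 2))) ≤
      (1 - q) / ((b - a) * (b - a * q)) := by
    rw [div_le_div_iff₀ (by positivity) (by positivity)]
    have k1 : (1 - q * Q) * (b - a) ≤ (1 - q) * (b - a * Q) := by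
      nlinarith [mul_nonneg (sub_nonneg.2 hqe) (sub_nonneg.2 hQ1)]
    have k2 : b - a * q ≤ b - a * (q * Q ^ 2) := by nlinarith
    calc (1 - q * Q) * ((b - a) * (b - a * q)) = ((1 - q * Q) * (b - a)) * (b - a * q) := by ring
      _ ≤ ((1 - q) * (b - a * Q)) * (b - a * (q * Q ^ 2)) := by
        apply mul_le_mul k1 k2 hD3.le; positivity
      _ = _ := by ring
  calc _ = (a * b * (b - a)) * (Q * ((1 - q * Q) / ((b - a * Q) * (b - a * (q * Q ^ 2))))) := by ring
    _ ≤ (a * b * (b - a)) * (R * ((1 - q) / ((b - a) * (b - a * q)))) := by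
      apply mul_le_mul_of_nonneg_left _ hc.le
      apply mul_le_mul hR key _ (hQ0.trans hR)
      apply div_nonneg _ (by positivity)
      nlinarith
    _ = _ := by ring

lemma lower_bound (a b q Q : ℝ) (ha : 0 < a) (hb : a < b) (hq0 : 0 < q) (hq1 : q < 1)
    (hQ0 : 0 ≤ Q) (hQ1 : Q ≤ 1) :
    (a * (b - a) * (1 - q) / b) * Q ≤ XX a b (q * Q ^ 2) - XX a b Q := by
  have hb0 : 0 < b := ha.trans hb
  have hD : 0 < b - a * Q := by nlinarith
  have hQ2 : q * Q ^ 2 ≤ q := mul_le_of_le_one_right hq0.le (pow_le_one₀ hQ0 hQ1)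
  have hD2 : 0 < b - a * (q * Q ^ 2) := by nlinarith
  have hba : 0 < b - a := by linarith
  have h1q : 0 < 1 - q := by linarith
  rw [XX_diff a b q Q hD.ne' hD2.ne', div_mul_eq_mul_div,
    div_le_div_iff₀ hb0 (by positivity)]
  have k1 : (b - a * Q) * (b - a * (q * Q ^ 2)) ≤ b * b := by
    apply mul_le_mul _ _ hD2.le hb0.le
    · nlinarith
    · have : 0 ≤ a * (q * Q ^ 2) := by positivity
      linarith
  have k2 : 1 - q ≤ 1 - q * Q := by nlinarith
  calc a * (b - a) * (1 - q) * Q * ((b - a * Q) * (b - a * (q * Q ^ 2)))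
      ≤ a * (b - a) * (1 - q * Q) * Q * (b * b) := by
        have : 0 ≤ 1 - q * Q := h1q.le.trans k2
        gcongr
    _ = _ := by ring

lemma zpow_aux (i : ℕ) : (2 : ℝ) ^ ((1 : ℤ) - 2 ^ i) = (1 / 2) ^ (2 ^ i - 1) := by
  have h : (1 : ℤ) - 2 ^ i = -((2 ^ i - 1 : ℕ) : ℤ) := by
    rw [Nat.cast_sub Nat.one_le_two_pow]; push_cast; ring
  rw [h, zpow_neg, zpow_natCast, one_div, inv_pow]

lemma Q_succ (q : ℝ) (i : ℕ) : q ^ (2 ^ (i + 1) - 1) = q * (q ^ (2 ^ i - 1)) ^ 2 := by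
  rw [← pow_mul, ← pow_succ']
  congr 1
  have : 1 ≤ 2 ^ i := Nat.one_le_two_pow
  rw [pow_succ]; omega

lemma exp_tendsto : Tendsto (fun i : ℕ => 2 ^ i - 1) atTop atTop := by
  apply tendsto_atTop_mono (f := fun i : ℕ => i) _ tendsto_id
  intro i
  have : i < 2 ^ i := Nat.lt_two_pow_self
  show i ≤ 2 ^ i - 1
  omega

lemma main_equiv (a b β γ q : ℝ) (hγ : 0 < γ) (ha : 0 < a) (hb : a < b) (hb1 : b < 1)
    (hab : 1 - a - b + a * b = 1 / 2) (hα : β * γ = 2 * a * b)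
    (hq : q = a * (1 - b) / (b * (1 - a))) :
    (∃ t : ℕ → ℝ, t 0 = 0 ∧
      (∀ i, γ * t i ≠ 1 ∧ deriv (hbg β γ) (t i) ≠ 0 ∧
        t (i + 1) = t i - hbg β γ (t i) / deriv (hbg β γ) (t i)) ∧
      (∀ i, |t (i + 1) - t i| ≤ 2 ^ ((1 : ℤ) - 2 ^ i) * |t 1 - t 0|) ∧
      ∃ l : ℝ, Filter.Tendsto t Filter.atTop (nhds l) ∧ hbg β γ l = 0) ↔ q ≤ 1 / 2 := by
  have hb0 : 0 < b := ha.trans hb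
  have h1a : 0 < 1 - a := by linarith
  have h1b : 0 < 1 - b := by linarith
  have hq0 : 0 < q := by rw [hq]; positivity
  have hqb : q * b ≤ a := by
    have : q * b = a * ((1 - b) / (1 - a)) := by rw [hq]; field_simp
    rw [this]
    have : (1 - b) / (1 - a) ≤ 1 := by rw [div_le_one h1a]; linarith
    nlinarith
  have hq1 : q < 1 := by
    by_contra h
    push Not at h
    nlinarith
  have hQ0 : ∀ i : ℕ, 0 < q ^ (2 ^ i - 1) := fun i => by positivity
  have hQ1 : ∀ i : ℕ, q ^ (2 ^ i - 1) ≤ 1 := fun i => pow_le_one₀ hq0.le hq1.le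
  constructor
  · rintro ⟨t, ht0, hrec, hbd, -⟩
    have ht : ∀ i, γ * t i = XX a b (q ^ (2 ^ i - 1)) := by
      intro i
      induction i with
      | zero => simp [ht0, XX]
      | succ i ih =>
        rw [(hrec i).2.2, Q_succ]
        exact newton_step a b β γ (t i) q _ hγ ha hb hb1 hab hα hq hq1 (hQ0 i).le (hQ1 i) ih
    by_contra hlt
    push Not at hlt
    set K := a * (b - a) * (1 - q) / b with hK
    have hKpos : 0 < K := by
      have : 0 < b - a := by linarith
      have : 0 < 1 - q := by linarith
      positivity
    have hall : ∀ i : ℕ, (2 * q) ^ (2 ^ i - 1) ≤ γ * |t 1 - t 0| / K := by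
      intro i
      rw [le_div_iff₀ hKpos]
      have e1 := lower_bound a b q _ ha hb hq0 hq1 (hQ0 i).le (hQ1 i)
      rw [← Q_succ, ← ht, ← ht, ← hK] at e1
      have e2 := hbd i
      rw [zpow_aux] at e2
      have e3 : γ * t (i + 1) - γ * t i ≤ γ * |t (i + 1) - t i| := by
        rw [← mul_sub]; exact mul_le_mul_of_nonneg_left (le_abs_self _) hγ.le
      have e4 : K * q ^ (2 ^ i - 1) ≤ γ * ((1 / 2) ^ (2 ^ i - 1) * |t 1 - t 0|) :=
        e1.trans (e3.trans (mul_le_mul_of_nonneg_left e2 hγ.le))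
      have e5 : (2 : ℝ) ^ (2 ^ i - 1) * (1 / 2) ^ (2 ^ i - 1) = 1 := by
        rw [← mul_pow]; norm_num
      calc (2 * q) ^ (2 ^ i - 1) * K = 2 ^ (2 ^ i - 1) * (K * q ^ (2 ^ i - 1)) := by
            rw [mul_pow]; ring
        _ ≤ 2 ^ (2 ^ i - 1) * (γ * ((1 / 2) ^ (2 ^ i - 1) * |t 1 - t 0|)) := by gcongr
        _ = (2 ^ (2 ^ i - 1) * (1 / 2) ^ (2 ^ i - 1)) * (γ * |t 1 - t 0|) := by ring
        _ = γ * |t 1 - t 0| := by rw [e5, one_mul]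
    have htd : Tendsto (fun i : ℕ => (2 * q) ^ (2 ^ i - 1)) atTop atTop :=
      (tendsto_pow_atTop_atTop_of_one_lt (by linarith)).comp exp_tendsto
    obtain ⟨i, hi⟩ := (htd.eventually_gt_atTop (γ * |t 1 - t 0| / K)).exists
    exact absurd (hall i) (not_le.2 hi)
  · intro hq2
    set t : ℕ → ℝ := fun i => XX a b (q ^ (2 ^ i - 1)) / γ with htdef
    have ht : ∀ i, γ * t i = XX a b (q ^ (2 ^ i - 1)) := by
      intro i; simp only [htdef]; field_simp
    have ht0 : t 0 = 0 := by simp [htdef, XX]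
    refine ⟨t, ht0, ?_, ?_, ?_⟩
    · intro i
      have hle : γ * t i ≤ a := by rw [ht]; exact XX_le a b _ ha hb (hQ0 i).le (hQ1 i)
      obtain ⟨h1, h2⟩ := deriv_ne a b β γ (t i) hb hb1 hab hle
      refine ⟨h1, h2, ?_⟩
      have := newton_step a b β γ (t i) q _ hγ ha hb hb1 hab hα hq hq1 (hQ0 i).le (hQ1 i) (ht i)
      rw [← Q_succ, ← ht] at this
      exact (mul_left_cancel₀ hγ.ne' this).symm
    · intro i
      rw [zpow_aux]
      have hba : 0 < b - a := by linarith
      have h1q : 0 < 1 - q := by linarith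
      have nn : ∀ j, 0 ≤ t (j + 1) - t j := by
        intro j
        have e1 := lower_bound a b q _ ha hb hq0 hq1 (hQ0 j).le (hQ1 j)
        rw [← Q_succ, ← ht, ← ht] at e1
        have e2 : 0 ≤ (a * (b - a) * (1 - q) / b) * q ^ (2 ^ j - 1) := by positivity
        have e3 : 0 ≤ γ * (t (j + 1) - t j) := by rw [mul_sub]; exact e2.trans e1
        exact nonneg_of_mul_nonneg_right e3 hγ
      rw [abs_of_nonneg (nn i), abs_of_nonneg (nn 0)]
      have hR : q ^ (2 ^ i - 1) ≤ (1 / 2 : ℝ) ^ (2 ^ i - 1) := pow_le_pow_left₀ hq0.le hq2 _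
      have e := ratio_bound a b q _ _ ha hb hq0 hq1 hqb (hQ0 i).le (hQ1 i) hR
      have f0 := ht 0
      have f1 := ht 1
      simp only [pow_zero, pow_one, Nat.sub_self] at f0 f1
      norm_num only at f1
      rw [pow_one] at f1
      rw [← Q_succ, ← ht, ← ht, ← f0, ← f1] at e
      refine le_of_mul_le_mul_left ?_ hγ
      linarith
    · refine ⟨a / γ, ?_, ?_⟩
      · have hQt : Tendsto (fun i : ℕ => q ^ (2 ^ i - 1)) atTop (𝓝 0) :=
          (tendsto_pow_atTop_nhds_zero_of_lt_one hq0.le hq1).comp exp_tendsto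
        have hn : Tendsto (fun i : ℕ => a * b * (1 - q ^ (2 ^ i - 1))) atTop (𝓝 (a * b * (1 - 0))) :=
          (hQt.const_sub 1).const_mul (a * b)
        have hd : Tendsto (fun i : ℕ => b - a * q ^ (2 ^ i - 1)) atTop (𝓝 (b - a * 0)) :=
          (hQt.const_mul a).const_sub b
        have := (hn.div hd (by simpa using hb0.ne')).div_const γ
        have e : a * b * (1 - 0) / (b - a * 0) / γ = a / γ := by
          simp only [sub_zero, mul_zero, mul_one]; field_simp
        rw [e] at this
        exact this
      · have e : γ * (a / γ) = a := by field_simp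
        rw [hbg_eq a b β γ (a / γ) hγ hab hα (by rw [e]; intro h; linarith), e]
        simp

theorem stmt10 (β γ : ℝ) (hβ : 0 < β) (hγ : 0 < γ)
    (hlt : β * γ < 3 - 2 * Real.sqrt 2) :
    (∃ t : ℕ → ℝ, t 0 = 0 ∧
      (∀ i, γ * t i ≠ 1 ∧ deriv (hbg β γ) (t i) ≠ 0 ∧
        t (i + 1) = t i - hbg β γ (t i) / deriv (hbg β γ) (t i)) ∧
      (∀ i, |t (i + 1) - t i| ≤ 2 ^ ((1 : ℤ) - 2 ^ i) * |t 1 - t 0|) ∧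
      ∃ l : ℝ, Filter.Tendsto t Filter.atTop (nhds l) ∧ hbg β γ l = 0) ↔
    β * γ ≤ (13 - 3 * Real.sqrt 17) / 4 := by
  have hα0 : 0 < β * γ := mul_pos hβ hγ
  set α := β * γ with hαdef
  have h2 : Real.sqrt 2 ^ 2 = 2 := Real.sq_sqrt (by norm_num)
  have h2l : 1.4 < Real.sqrt 2 := Real.lt_sqrt_of_sq_lt (by norm_num)
  have h17 : Real.sqrt 17 ^ 2 = 17 := Real.sq_sqrt (by norm_num)
  have h17l : 4 < Real.sqrt 17 := Real.lt_sqrt_of_sq_lt (by norm_num)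
  have hα1 : α < 0.2 := by linarith
  have hdisc : 0 < (1 + α) ^ 2 - 8 * α := by nlinarith
  set s := Real.sqrt ((1 + α) ^ 2 - 8 * α) with hs
  have hs0 : 0 < s := Real.sqrt_pos.2 hdisc
  have hs2 : s ^ 2 = (1 + α) ^ 2 - 8 * α := Real.sq_sqrt hdisc.le
  have hsl : s < 1 + α := by nlinarith
  have hsm : s < 3 - α := by linarith
  have ha : 0 < (1 + α - s) / 4 := by linarith
  have hb : (1 + α - s) / 4 < (1 + α + s) / 4 := by linarith
  have hb1 : (1 + α + s) / 4 < 1 := by linarith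
  rw [main_equiv ((1 + α - s) / 4) ((1 + α + s) / 4) β γ _ hγ ha hb hb1
    (by linear_combination (-1/16) * hs2) (by rw [← hαdef]; linear_combination (1/8) * hs2) rfl]
  rw [div_le_iff₀ (mul_pos (ha.trans hb) (by linarith))]
  have step : (1 + α - s) / 4 * (1 - (1 + α + s) / 4) ≤
      1 / 2 * ((1 + α + s) / 4 * (1 - (1 + α - s) / 4)) ↔ 1 - α ≤ 3 * s := by
    constructor <;> intro h <;> nlinarith
  rw [step]
  constructor
  · intro h
    by_contra hc
    push Not at hc
    have : (1 - α) ^ 2 ≤ (3 * s) ^ 2 := pow_le_pow_left₀ (by linarith) h 2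
    nlinarith
  · intro h
    apply le_of_sq_le_sq _ (by linarith)
    nlinarith
end

section
/- Let A be an invertible real n×n matrix (n ≥ 1). Then the distance, in Frobenius norm, from A to the set of singular matrices equals the reciprocal of the spectral norm of A⁻¹: inf{‖B‖_F : B an n×n real matrix with det(A+B) = 0} = 1/‖A⁻¹‖₂, and this infimum is attained by some B with det(A+B) = 0 and ‖B‖_F = 1/‖A⁻¹‖₂. -/
/-- The Frobenius norm of a real square matrix. -/
noncomputable def frobNorm {n : ℕ} (M : Matrix (Fin n) (Fin n) ℝ) : ℝ :=
  Real.sqrt (∑ i, ∑ j, M i j ^ 2)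

/-- The spectral norm (operator norm induced by the Euclidean norm) of a real square
matrix. -/
noncomputable def specNorm {n : ℕ} (M : Matrix (Fin n) (Fin n) ℝ) : ℝ :=
  ‖LinearMap.toContinuousLinearMap (Matrix.toEuclideanLin M)‖

theorem aux_frob {n : ℕ} (B : Matrix (Fin n) (Fin n) ℝ) (v : Fin n → ℝ) :
    ‖WithLp.toLp 2 (B.mulVec v)‖ ≤ frobNorm B * ‖WithLp.toLp 2 v‖ := by
  rw [EuclideanSpace.norm_eq, EuclideanSpace.norm_eq, frobNorm]
  have h0 : 0 ≤ ∑ i, ∑ j, B i j ^ 2 :=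
    Finset.sum_nonneg fun i _ => Finset.sum_nonneg fun j _ => sq_nonneg (B i j)
  refine le_trans ?_ (Real.sqrt_mul h0 _).le
  apply Real.sqrt_le_sqrt
  rw [Finset.sum_mul]
  apply Finset.sum_le_sum
  intro i _
  simp only [Real.norm_eq_abs, sq_abs, Matrix.mulVec, dotProduct]
  exact Finset.sum_mul_sq_le_sq_mul_sq _ _ _

theorem aux_spec {n : ℕ} (B : Matrix (Fin n) (Fin n) ℝ) (v : Fin n → ℝ) :
    ‖WithLp.toLp 2 (B.mulVec v)‖ ≤ specNorm B * ‖WithLp.toLp 2 v‖ :=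
  (LinearMap.toContinuousLinearMap (Matrix.toEuclideanLin B)).le_opNorm (WithLp.toLp 2 v)

theorem aux_attain {n : ℕ} (hn : 1 ≤ n) (B : Matrix (Fin n) (Fin n) ℝ) :
    ∃ x : Fin n → ℝ, ‖WithLp.toLp 2 x‖ = 1 ∧ ‖WithLp.toLp 2 (B.mulVec x)‖ = specNorm B := by
  set T := LinearMap.toContinuousLinearMap (Matrix.toEuclideanLin B) with hT
  have : Nonempty (Fin n) := ⟨⟨0, hn⟩⟩
  obtain ⟨x, hx, hm⟩ := (isCompact_sphere (0 : EuclideanSpace ℝ (Fin n)) 1).exists_isMaxOn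
    (NormedSpace.sphere_nonempty.2 zero_le_one) (f := fun x => ‖T x‖) (by fun_prop)
  have hx1 : ‖x‖ = 1 := by simpa using hx
  refine ⟨x.ofLp, hx1, le_antisymm ?_ ?_⟩
  · have h := aux_spec B x.ofLp
    have h1 : ‖WithLp.toLp 2 x.ofLp‖ = 1 := hx1
    rwa [h1, mul_one] at h
  · refine T.opNorm_le_of_unit_norm (norm_nonneg _) fun z hz => ?_
    exact hm (by simpa using hz)

theorem stmt14 (n : ℕ) (hn : 1 ≤ n) (A : Matrix (Fin n) (Fin n) ℝ)
    (hA : IsUnit A.det) :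
    IsLeast {r : ℝ | ∃ B : Matrix (Fin n) (Fin n) ℝ, (A + B).det = 0 ∧ r = frobNorm B}
      (specNorm A⁻¹)⁻¹ := by
  constructor
  · obtain ⟨x, hx, hs⟩ := aux_attain hn A⁻¹
    set y := A⁻¹.mulVec x with hy
    set s := specNorm A⁻¹ with hsdef
    have hAy : A.mulVec y = x := by
      rw [hy, Matrix.mulVec_mulVec, Matrix.mul_nonsing_inv _ hA, Matrix.one_mulVec]
    have hy0 : y ≠ 0 := by
      intro h
      rw [h, Matrix.mulVec_zero] at hAy
      rw [← hAy] at hx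
      simp at hx
    have hspos : 0 < s := by
      rw [← hs, norm_pos_iff]
      intro h
      exact hy0 (by simpa using h)
    have hyy : ∑ j, y j ^ 2 = s ^ 2 := by
      rw [← hs, EuclideanSpace.norm_sq_eq]
      simp
    have hxx : ∑ j, x j ^ 2 = 1 := by
      have := EuclideanSpace.norm_sq_eq (WithLp.toLp 2 x)
      rw [hx] at this
      simpa using this.symm
    refine ⟨Matrix.of fun i j => -(x i * y j / s ^ 2), ?_, ?_⟩
    · apply Matrix.exists_mulVec_eq_zero_iff.1
      refine ⟨y, hy0, ?_⟩
      rw [Matrix.add_mulVec, hAy]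
      ext i
      have : ∑ j, -(x i * y j / s ^ 2) * y j = -(x i / s ^ 2) * ∑ j, y j ^ 2 := by
        rw [Finset.mul_sum]
        exact Finset.sum_congr rfl fun j _ => by ring
      simp only [Pi.add_apply, Matrix.mulVec, dotProduct, Matrix.of_apply, Pi.zero_apply]
      rw [this, hyy]
      field_simp
      ring
    · have : ∑ i, ∑ j, (-(x i * y j / s ^ 2)) ^ 2 = (s⁻¹) ^ 2 := by
        have h : ∀ i, ∑ j, (-(x i * y j / s ^ 2)) ^ 2 = x i ^ 2 * (s⁻¹) ^ 2 := by
          intro i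
          have : ∑ j, (-(x i * y j / s ^ 2)) ^ 2 = x i ^ 2 / s ^ 4 * ∑ j, y j ^ 2 := by
            rw [Finset.mul_sum]
            exact Finset.sum_congr rfl fun j _ => by ring
          rw [this, hyy]
          field_simp
        simp only [h]
        rw [← Finset.sum_mul, hxx, one_mul]
      simp only [frobNorm, Matrix.of_apply]
      rw [this, Real.sqrt_sq (by positivity)]
  · rintro r ⟨B, hB, rfl⟩
    obtain ⟨v, hv, h0⟩ := Matrix.exists_mulVec_eq_zero_iff.2 hB
    have hvn : 0 < ‖WithLp.toLp 2 v‖ := by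
      rw [norm_pos_iff]
      intro h
      exact hv (by simpa using h)
    rw [Matrix.add_mulVec] at h0
    have hv2 : A⁻¹.mulVec (B.mulVec v) = -v := by
      rw [eq_neg_of_add_eq_zero_right h0, Matrix.mulVec_neg, Matrix.mulVec_mulVec,
        Matrix.nonsing_inv_mul _ hA, Matrix.one_mulVec]
    have h1 := aux_spec A⁻¹ (B.mulVec v)
    rw [hv2, WithLp.toLp_neg, norm_neg] at h1
    have hs0 : 0 ≤ specNorm A⁻¹ := norm_nonneg _
    have h2 := h1.trans (mul_le_mul_of_nonneg_left (aux_frob B v) hs0)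
    have h3 : 1 ≤ specNorm A⁻¹ * frobNorm B := by
      by_contra hc
      nlinarith [not_le.1 hc]
    have hsp : 0 < specNorm A⁻¹ := by
      rcases hs0.eq_or_lt with h | h
      · rw [← h] at h3
        norm_num at h3
      · exact h
    rw [inv_le_iff_one_le_mul₀ hsp]
    linarith
end

section
/- Let y₁, …, y_s be points of the unit sphere S^n ⊂ ℝ^{n+1} lying in a common open hemisphere, i.e. there is z with ⟨y_i, z⟩ > 0 for all i. Let r₁, …, r_s > 0 and let B(y_i, r_i) = {x ∈ S^n : ρ(x, y_i) < r_i} be the corresponding spherical caps. If the intersection ⋂_i B(y_i, r_i) is nonempty, then the spherical convex hull SCH(y₁, …, y_s) is contained in the union ⋃_i B(y_i, r_i). -/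
open scoped RealInnerProductSpace

/-- convexity lemma: let `y₁, …, y_s` be points of the unit sphere
`S^n ⊆ ℝ^(n+1)` lying in a common open hemisphere, and let `B(y_i, r_i)` be spherical caps
(for the angular distance `ρ(x,y) = arccos ⟪x,y⟫`) with nonempty intersection.  Then every
point of the spherical convex hull of the `y_i` belongs to some cap `B(y_i, r_i)`. -/
theorem stmt16 (n s : ℕ) (y : Fin s → EuclideanSpace ℝ (Fin (n + 1)))
    (hy : ∀ i, ‖y i‖ = 1)
    (z : EuclideanSpace ℝ (Fin (n + 1))) (hz : ∀ i, 0 < ⟪y i, z⟫)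
    (r : Fin s → ℝ) (hr : ∀ i, 0 < r i)
    (p : EuclideanSpace ℝ (Fin (n + 1))) (hp : ‖p‖ = 1)
    (hpmem : ∀ i, Real.arccos ⟪p, y i⟫ < r i)
    (lam : Fin s → ℝ) (hlam : ∀ i, 0 ≤ lam i) (hsum : ∑ j, lam j = 1) :
    (∑ j, lam j • y j) ≠ 0 ∧
      ∃ i, Real.arccos ⟪‖∑ j, lam j • y j‖⁻¹ • ∑ j, lam j • y j, y i⟫ < r i := by
  have key : ∀ f : Fin s → ℝ, (∀ i, 0 < f i) → 0 < ∑ j, lam j * f j := by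
    intro f hf
    have h0 : ∃ j, lam j ≠ 0 := by
      by_contra! h
      simp [h] at hsum
    obtain ⟨j, hj⟩ := h0
    refine Finset.sum_pos' (fun i _ => mul_nonneg (hlam i) (hf i).le) ⟨j, Finset.mem_univ j, ?_⟩
    exact mul_pos (lt_of_le_of_ne (hlam j) (Ne.symm hj)) (hf j)
  have hin : ∀ v : EuclideanSpace ℝ (Fin (n + 1)),
      ⟪v, ∑ j, lam j • y j⟫ = ∑ j, lam j * ⟪v, y j⟫ := by
    intro v
    rw [inner_sum]
    simp only [real_inner_smul_right]
  have hw : (∑ j, lam j • y j) ≠ 0 := by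
    intro h
    have h1 := key (fun i => ⟪y i, z⟫) hz
    have h2 := hin z
    rw [h, inner_zero_right] at h2
    simp only [real_inner_comm] at h1 h2
    linarith
  refine ⟨hw, ?_⟩
  by_contra! hcon
  set w := ∑ j, lam j • y j with hwdef
  have hlt : ∀ i, 0 < ⟪p - ‖w‖⁻¹ • w, y i⟫ := by
    intro i
    by_contra! hle
    rw [inner_sub_left] at hle
    have := Real.arccos_le_arccos (sub_nonpos.mp hle)
    linarith [hcon i, hpmem i]
  have h1 := key _ hlt
  rw [← hin, inner_sub_left, real_inner_smul_left, real_inner_self_eq_norm_sq] at h1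
  have h2 := real_inner_le_norm p w
  have h3 : ‖w‖⁻¹ * ‖w‖ ^ 2 = ‖w‖ := by
    have : ‖w‖ ≠ 0 := norm_ne_zero_iff.mpr hw
    field_simp
  rw [hp, one_mul] at h2
  linarith
end
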